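/- Let a, b : [0,∞) × ℝ → ℝ be bounded continuous functions that are 2π-periodic in their second argument, and let v : [0,∞) × ℝ → ℝ be a classical solution of the linear parabolic equation v_t = v_xx + a(t,x)·v_x + b(t,x)·v on the circle (i.e., v is continuous on [0,∞) × ℝ, 2π-periodic in x, its partial derivatives v_t, v_x, v_xx exist and are continuous on (0,∞) × ℝ and satisfy the equation there), and assume v(t,·) is not identically zero for every t ≥ 0. Then (i) for every t > 0 the set {x ∈ [0,2π) : v(t,x) = 0} is finite, and (ii) for all 0 < t₁ ≤ t₂, the cardinality of {x ∈ [0,2π) : v(t₂,x) = 0} is at most the cardinality of {x ∈ [0,2π) : v(t₁,x) = 0}. -/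

import Mathlib

open Real Set


namespace ZN
open MeasureTheory Filter Topology

/-- Gaussian weight. -/
noncomputable def GW (y : ℝ) : ℝ := Real.exp (-(y ^ 2 / 4))

/-- continuous, with at most exponential growth -/
def CE (f : ℝ → ℝ) : Prop := Continuous f ∧ ∃ C κ : ℝ, 0 ≤ C ∧ 0 ≤ κ ∧ ∀ y, |f y| ≤ C * Real.exp (κ * |y|)

lemma GW_pos (y : ℝ) : 0 < GW y := Real.exp_pos _

lemma GW_cont : Continuous GW := by unfold GW; fun_prop

/-- change the function and the derivative in `HasDerivAt` -/
lemma hd {f g : ℝ → ℝ} {f' g' x : ℝ} (h : HasDerivAt f f' x) (e : ∀ y, g y = f y) (e' : g' = f') :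
    HasDerivAt g g' x := by
  have : g = f := funext e
  rw [this, e']; exact h

lemma GW_deriv (y : ℝ) : HasDerivAt GW (-(y / 2) * GW y) y := by
  unfold GW
  have h : HasDerivAt (fun y : ℝ => -(y ^ 2 / 4)) (-(y / 2)) y := by
    have := ((hasDerivAt_pow 2 y).div_const 4).neg
    exact hd this (fun y => rfl) (by norm_num; ring)
  exact hd h.exp (fun y => rfl) (by ring)

lemma CE.add {f g : ℝ → ℝ} (hf : CE f) (hg : CE g) : CE (fun y => f y + g y) := by
  obtain ⟨hfc, C, κ, hC, hκ, hf⟩ := hf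
  obtain ⟨hgc, C', κ', hC', hκ', hg⟩ := hg
  refine ⟨hfc.add hgc, C + C', κ + κ', by positivity, by positivity, fun y => ?_⟩
  have h1 : Real.exp (κ * |y|) ≤ Real.exp ((κ + κ') * |y|) := by
    apply Real.exp_le_exp.2; nlinarith [abs_nonneg y]
  have h2 : Real.exp (κ' * |y|) ≤ Real.exp ((κ + κ') * |y|) := by
    apply Real.exp_le_exp.2; nlinarith [abs_nonneg y]
  calc |f y + g y| ≤ |f y| + |g y| := abs_add_le _ _
    _ ≤ C * Real.exp (κ * |y|) + C' * Real.exp (κ' * |y|) := add_le_add (hf y) (hg y)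
    _ ≤ C * Real.exp ((κ + κ') * |y|) + C' * Real.exp ((κ + κ') * |y|) := by gcongr
    _ = _ := by ring

lemma CE.mul {f g : ℝ → ℝ} (hf : CE f) (hg : CE g) : CE (fun y => f y * g y) := by
  obtain ⟨hfc, C, κ, hC, hκ, hf⟩ := hf
  obtain ⟨hgc, C', κ', hC', hκ', hg⟩ := hg
  refine ⟨hfc.mul hgc, C * C', κ + κ', by positivity, by positivity, fun y => ?_⟩
  calc |f y * g y| = |f y| * |g y| := abs_mul _ _
    _ ≤ (C * Real.exp (κ * |y|)) * (C' * Real.exp (κ' * |y|)) :=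
        mul_le_mul (hf y) (hg y) (abs_nonneg _) (by positivity)
    _ = _ := by rw [add_mul, Real.exp_add]; ring

lemma CE.const (c : ℝ) : CE (fun _ => c) :=
  ⟨continuous_const, |c|, 0, abs_nonneg _, le_rfl, fun y => by simp⟩

lemma CE.id : CE (fun y => y) :=
  ⟨continuous_id, 1, 1, by norm_num, by norm_num, fun y => by
    have := Real.add_one_le_exp |y|; simp; linarith⟩

lemma CE.const_mul {f : ℝ → ℝ} (c : ℝ) (hf : CE f) : CE (fun y => c * f y) := (CE.const c).mul hf

lemma CE.neg {f : ℝ → ℝ} (hf : CE f) : CE (fun y => - f y) := by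
  simpa using hf.const_mul (-1)

lemma CE.sub {f g : ℝ → ℝ} (hf : CE f) (hg : CE g) : CE (fun y => f y - g y) := by
  simpa [sub_eq_add_neg] using hf.add hg.neg

lemma CE.sum {ι : Type*} (s : Finset ι) {f : ι → ℝ → ℝ} (hf : ∀ i ∈ s, CE (f i)) :
    CE (fun y => ∑ i ∈ s, f i y) := by
  classical
  induction s using Finset.induction_on with
  | empty => simpa using CE.const 0
  | insert a s ha ih =>
    simp only [Finset.sum_insert ha]
    exact (hf a (by simp)).add (ih fun i hi => hf i (by simp [hi]))

lemma CE.half {f : ℝ → ℝ} (hf : CE f) : CE (fun y => y / 2 * f y) := by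
  have := (CE.id.const_mul (1/2)).mul hf
  convert this using 2; ring

lemma exp_abs_integrable (κ : ℝ) (c : ℝ) (hc : 0 < c) :
    Integrable (fun y : ℝ => Real.exp (κ * |y|) * Real.exp (-(c * y ^ 2))) := by
  have h := (integrable_exp_neg_mul_sq (show (0:ℝ) < c / 2 by positivity)).const_mul
    (Real.exp (κ ^ 2 / (2 * c)))
  refine h.mono' (by fun_prop) (Eventually.of_forall fun y => ?_)
  rw [← Real.exp_add, ← Real.exp_add, Real.norm_eq_abs, abs_of_pos (Real.exp_pos _)]
  apply Real.exp_le_exp.2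
  have h1 : κ * |y| ≤ κ ^ 2 / (2 * c) + c / 2 * y ^ 2 := by
    rw [← sq_abs y, ← sub_nonneg]
    have : κ ^ 2 / (2 * c) + c / 2 * |y| ^ 2 - κ * |y| = (κ - c * |y|) ^ 2 / (2 * c) := by
      field_simp; ring
    rw [this]; positivity
  linarith

lemma CE.int {f : ℝ → ℝ} (hf : CE f) : Integrable (fun y => f y * GW y) := by
  obtain ⟨hfc, C, κ, hC, hκ, hf⟩ := hf
  have h := (exp_abs_integrable κ (1/4) (by norm_num)).const_mul C
  refine h.mono' ((hfc.mul GW_cont).aestronglyMeasurable) (Eventually.of_forall fun y => ?_)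
  rw [Real.norm_eq_abs, abs_mul, abs_of_pos (GW_pos y), ← mul_assoc]
  refine mul_le_mul (hf y) (le_of_eq ?_) (GW_pos y).le (by positivity)
  unfold GW; congr 1; ring

/-- Gaussian integral -/
noncomputable def gi (f : ℝ → ℝ) : ℝ := ∫ y, f y * GW y

lemma gi_add {f g : ℝ → ℝ} (hf : CE f) (hg : CE g) : gi (fun y => f y + g y) = gi f + gi g := by
  unfold gi
  rw [← integral_add hf.int hg.int]
  congr 1; ext y; ring

lemma gi_const_mul (c : ℝ) (f : ℝ → ℝ) : gi (fun y => c * f y) = c * gi f := by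
  unfold gi
  rw [← integral_const_mul]
  congr 1; ext y; ring

lemma gi_sub {f g : ℝ → ℝ} (hf : CE f) (hg : CE g) : gi (fun y => f y - g y) = gi f - gi g := by
  unfold gi
  rw [← integral_sub hf.int hg.int]
  congr 1; ext y; ring

lemma gi_sum {ι : Type*} (s : Finset ι) {f : ι → ℝ → ℝ} (hf : ∀ i ∈ s, CE (f i)) :
    gi (fun y => ∑ i ∈ s, f i y) = ∑ i ∈ s, gi (f i) := by
  unfold gi
  rw [← integral_finsetSum s (fun i hi => (hf i hi).int)]
  congr 1; ext y; rw [Finset.sum_mul]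

lemma gi_mono {f g : ℝ → ℝ} (hf : CE f) (hg : CE g) (h : ∀ y, f y ≤ g y) : gi f ≤ gi g :=
  integral_mono hf.int hg.int fun y => mul_le_mul_of_nonneg_right (h y) (GW_pos y).le

lemma gi_nonneg {f : ℝ → ℝ} (h : ∀ y, 0 ≤ f y) : 0 ≤ gi f :=
  integral_nonneg fun y => mul_nonneg (h y) (GW_pos y).le

lemma gi_pos {f : ℝ → ℝ} (hf : CE f) (h : ∀ y, 0 ≤ f y) (y₀ : ℝ) (h0 : f y₀ ≠ 0) : 0 < gi f := by
  unfold gi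
  apply integral_pos_of_integrable_nonneg_nonzero (x := y₀) (hf.1.mul GW_cont) hf.int
  · intro y; exact mul_nonneg (h y) (GW_pos y).le
  · exact mul_ne_zero h0 (GW_pos _).ne'

/-- integration by parts -/
lemma gi_ibp {f f' g g' : ℝ → ℝ} (hf : CE f) (hf' : CE f') (hg : CE g) (hg' : CE g')
    (df : ∀ y, HasDerivAt f (f' y) y) (dg : ∀ y, HasDerivAt g (g' y) y) :
    gi (fun y => f' y * g y) = gi (fun y => f y * (y / 2 * g y - g' y)) := by
  have h : ∫ y, (f' y * g y - f y * (y / 2 * g y - g' y)) * GW y = 0 := by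
    refine integral_eq_zero_of_hasDerivAt_of_integrable (f := fun y => (f y * g y) * GW y) ?_ ?_ ?_
    · intro y
      exact hd (((df y).mul (dg y)).mul (GW_deriv y)) (fun y => rfl) (by simp only [Pi.mul_apply]; ring)
    · exact ((hf'.mul hg).sub (hf.mul (hg.half.sub hg'))).int
    · exact (hf.mul hg).int
  have h2 := gi_sub (hf'.mul hg) (hf.mul (hg.half.sub hg'))
  unfold gi at h2 ⊢
  rw [h] at h2
  linarith

/-- Ornstein-Uhlenbeck operator is minus the Dirichlet form -/
lemma gi_L {f' f'' g g' : ℝ → ℝ} (hf' : CE f') (hf'' : CE f'') (hg : CE g)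
    (hg' : CE g') (df' : ∀ y, HasDerivAt f' (f'' y) y)
    (dg : ∀ y, HasDerivAt g (g' y) y) :
    gi (fun y => (f'' y - y / 2 * f' y) * g y) = - gi (fun y => f' y * g' y) := by
  have h := gi_ibp hg hg' hf' hf'' dg df'
  have e1 : gi (fun y => (f'' y - y / 2 * f' y) * g y) =
      - gi (fun y => g y * (y / 2 * f' y - f'' y)) := by
    rw [← neg_one_mul, ← gi_const_mul]; congr 1; ext y; ring
  rw [e1, ← h]; congr 2; ext y; ring

lemma gi_cs {f g : ℝ → ℝ} (hf : CE f) (hg : CE g) :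
    (gi (fun y => f y * g y)) ^ 2 ≤ gi (fun y => f y ^ 2) * gi (fun y => g y ^ 2) := by
  have hq : ∀ x : ℝ, 0 ≤ gi (fun y => g y ^ 2) * (x * x) + (2 * gi (fun y => f y * g y)) * x
      + gi (fun y => f y ^ 2) := by
    intro x
    have h0 : 0 ≤ gi (fun y => (f y + x * g y) ^ 2) := gi_nonneg fun y => sq_nonneg _
    have hff : CE (fun y => f y ^ 2) := by simpa [sq] using hf.mul hf
    have hgg : CE (fun y => g y ^ 2) := by simpa [sq] using hg.mul hg
    have e : gi (fun y => (f y + x * g y) ^ 2) = gi (fun y => (x * x) * g y ^ 2) +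
        gi (fun y => (2 * x) * (f y * g y)) + gi (fun y => f y ^ 2) := by
      rw [← gi_add (hgg.const_mul _) ((hf.mul hg).const_mul _),
        ← gi_add ((hgg.const_mul _).add ((hf.mul hg).const_mul _)) hff]
      congr 1; ext y; ring
    rw [e, gi_const_mul, gi_const_mul] at h0
    linarith
  have := discrim_le_zero hq
  unfold discrim at this
  nlinarith

end ZN


namespace ZN
open MeasureTheory Filter Topology

/-- heat polynomials -/
noncomputable def HP : ℕ → ℝ → ℝ → ℝ
  | 0, _, _ => 1
  | 1, _, y => y
  | (n + 2), θ, y => y * HP (n + 1) θ y + 2 * θ * ((n : ℝ) + 1) * HP n θ y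

lemma HP_zero (θ y : ℝ) : HP 0 θ y = 1 := rfl

lemma HP_succ (n : ℕ) (θ y : ℝ) : HP (n + 1) θ y = y * HP n θ y + 2 * θ * n * HP (n - 1) θ y := by
  cases n with
  | zero => simp [HP]
  | succ n => simp [HP]

lemma HP_at_zero (n : ℕ) (y : ℝ) : HP n 0 y = y ^ n := by
  induction n with
  | zero => simp [HP]
  | succ n ih => rw [HP_succ, ih]; ring

lemma HP_dy (n : ℕ) (θ y : ℝ) : HasDerivAt (fun y => HP n θ y) (n * HP (n - 1) θ y) y := by
  induction n using Nat.strong_induction_on with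
  | _ n ih =>
    match n, ih with
    | 0, _ => simpa [HP] using hasDerivAt_const y (1:ℝ)
    | 1, _ => exact hd (hasDerivAt_id y) (fun y => rfl) (by simp [HP])
    | n + 2, ih =>
      have h1 := ih (n + 1) (by omega)
      have h0 := ih n (by omega)
      have h := ((hasDerivAt_id y).mul h1).add (h0.const_mul (2 * θ * ((n : ℝ) + 1)))
      have e := HP_succ n θ y
      simp only [id, Nat.add_sub_cancel] at h
      refine hd h (fun y => rfl) ?_
      simp only [show n + 2 - 1 = n + 1 by omega]
      push_cast
      rw [e]; ring

lemma HP_dθ (n : ℕ) (θ y : ℝ) :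
    HasDerivAt (fun θ => HP n θ y) (n * (((n - 1 : ℕ) : ℝ) * HP (n - 2) θ y)) θ := by
  induction n using Nat.strong_induction_on with
  | _ n ih =>
    match n, ih with
    | 0, _ => simpa [HP] using hasDerivAt_const θ (1:ℝ)
    | 1, _ => simpa [HP] using hasDerivAt_const θ y
    | n + 2, ih =>
      have h1 := ih (n + 1) (by omega)
      have h0 := ih n (by omega)
      have h := (h1.const_mul y).add ((((hasDerivAt_id θ).const_mul 2).mul_const ((n : ℝ) + 1)).mul h0)
      simp only [id, Nat.add_sub_cancel] at h
      refine hd h (fun y => rfl) ?_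
      simp only [show n + 2 - 1 = n + 1 by omega, show n + 2 - 2 = n by omega,
        show n + 1 - 2 = n - 1 by omega]
      cases n with
      | zero => simp; 
      | succ m =>
        have e := HP_succ m θ y
        simp only [Nat.add_sub_cancel, show m + 1 - 2 = m - 1 by omega]
        push_cast
        rw [e]; ring

lemma HP_bound (n : ℕ) : ∃ C : ℝ, 0 ≤ C ∧ ∀ θ y : ℝ, |θ| ≤ 1 → |HP n θ y| ≤ C * Real.exp (n * |y|) := by
  induction n using Nat.strong_induction_on with
  | _ n ih =>
    match n, ih with
    | 0, _ => exact ⟨1, by norm_num, fun θ y _ => by simp [HP]⟩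
    | 1, _ => exact ⟨1, by norm_num, fun θ y _ => by
        have := Real.add_one_le_exp |y|; simp [HP]; linarith⟩
    | n + 2, ih =>
      obtain ⟨C1, hC1, h1⟩ := ih (n + 1) (by omega)
      obtain ⟨C0, hC0, h0⟩ := ih n (by omega)
      refine ⟨C1 + 2 * (n + 1) * C0, by positivity, fun θ y hθ => ?_⟩
      have h1 := h1 θ y hθ
      have h0 := h0 θ y hθ
      have hy : |y| ≤ Real.exp |y| := by linarith [Real.add_one_le_exp |y|]
      have e2 : Real.exp (((n + 2 : ℕ) : ℝ) * |y|) = Real.exp |y| * Real.exp (((n + 1 : ℕ) : ℝ) * |y|) := by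
        rw [← Real.exp_add]; congr 1; push_cast; ring
      have e3 : Real.exp ((n : ℝ) * |y|) ≤ Real.exp (((n + 2 : ℕ) : ℝ) * |y|) := by
        apply Real.exp_le_exp.2; push_cast; nlinarith [abs_nonneg y]
      have a1 : |y * HP (n + 1) θ y| ≤ C1 * Real.exp (((n + 2 : ℕ) : ℝ) * |y|) := by
        rw [abs_mul, e2]
        calc |y| * |HP (n + 1) θ y| ≤ Real.exp |y| * (C1 * Real.exp (((n + 1 : ℕ) : ℝ) * |y|)) :=
              mul_le_mul hy h1 (abs_nonneg _) (Real.exp_pos _).le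
          _ = _ := by ring
      have a2 : |2 * θ * ((n : ℝ) + 1) * HP n θ y| ≤ 2 * (n + 1) * C0 * Real.exp (((n + 2 : ℕ) : ℝ) * |y|) := by
        rw [abs_mul, abs_mul, abs_mul, abs_of_pos (show (0:ℝ) < 2 by norm_num),
          abs_of_pos (show (0:ℝ) < (n : ℝ) + 1 by positivity)]
        calc 2 * |θ| * ((n : ℝ) + 1) * |HP n θ y| ≤ 2 * 1 * ((n : ℝ) + 1) * (C0 * Real.exp (((n + 2 : ℕ) : ℝ) * |y|)) := by
              gcongr
              exact h0.trans (by gcongr)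
          _ = _ := by ring
      calc |HP (n + 2) θ y| ≤ _ := abs_add_le _ _
        _ ≤ _ := add_le_add a1 a2
        _ = _ := by ring

lemma HP_bound_gauss (n : ℕ) : ∃ C : ℝ, 0 ≤ C ∧ ∀ θ y : ℝ, |θ| ≤ 1 → |HP n θ y| ≤ C * Real.exp (y ^ 2 / 7) := by
  obtain ⟨C, hC, h⟩ := HP_bound n
  refine ⟨C * Real.exp (7 * n ^ 2 / 4), by positivity, fun θ y hθ => (h θ y hθ).trans ?_⟩
  rw [mul_assoc, ← Real.exp_add]
  gcongr
  rw [← sq_abs y]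
  nlinarith [sq_nonneg (2 * |y| - 7 * n)]

/-- Hermite polynomials for the weight `GW` -/
noncomputable def He (n : ℕ) (y : ℝ) : ℝ := HP n (-1) y

lemma He_dy (n : ℕ) (y : ℝ) : HasDerivAt (He n) (n * He (n - 1) y) y := HP_dy n (-1) y

lemma He_cont (n : ℕ) : Continuous (He n) :=
  continuous_iff_continuousAt.2 fun y => (He_dy n y).continuousAt

lemma He_CE (n : ℕ) : CE (He n) := by
  obtain ⟨C, hC, h⟩ := HP_bound n
  exact ⟨He_cont n, C, n, hC, by positivity, fun y => h (-1) y (by simp)⟩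

lemma He_dCE (n : ℕ) : CE (fun y => n * He (n - 1) y) := (He_CE _).const_mul _

lemma He_ddy (n : ℕ) (y : ℝ) :
    HasDerivAt (fun y => n * He (n - 1) y) (n * (((n - 1 : ℕ) : ℝ) * He (n - 2) y)) y :=
  (He_dy (n - 1) y).const_mul _

lemma He_L (n : ℕ) (y : ℝ) :
    n * (((n - 1 : ℕ) : ℝ) * He (n - 2) y) - y / 2 * (n * He (n - 1) y) = - (n / 2) * He n y := by
  cases n with
  | zero => simp
  | succ n =>
    have := HP_succ n (-1) y
    unfold He
    simp only [Nat.add_sub_cancel, show n + 1 - 2 = n - 1 by omega]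
    rw [this]; push_cast; ring

lemma He_norm_pos (n : ℕ) : 0 < gi (fun y => He n y ^ 2) := by
  have h : CE (fun y => He n y ^ 2) := by simpa [sq] using (He_CE n).mul (He_CE n)
  by_contra hc
  have hz : ∀ y, He n y = 0 := by
    intro y
    by_contra hy
    exact hc (gi_pos h (fun y => sq_nonneg _) y (pow_ne_zero 2 hy))
  -- all derivatives vanish, contradiction
  have : ∀ k, k ≤ n → ∀ y, He (n - k) y = 0 := by
    intro k
    induction k with
    | zero => intro _ y; exact hz y
    | succ k ih =>
      intro hk y
      have h1 := He_dy (n - k) y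
      have h2 : He (n - k) = fun _ => 0 := funext (ih (by omega))
      rw [h2] at h1
      have := h1.unique (hasDerivAt_const y 0)
      rw [show n - k - 1 = n - (k + 1) by omega] at this
      rcases mul_eq_zero.1 this with h | h
      · exfalso
        have : n - k = 0 := by exact_mod_cast h
        omega
      · exact h
  have := this n le_rfl 0
  rw [Nat.sub_self] at this
  norm_num [He, HP] at this

/-- testing `L f` against a Hermite polynomial -/
lemma gi_L_He {f f' f'' : ℝ → ℝ} (hf : CE f) (hf' : CE f') (hf'' : CE f'')
    (df : ∀ y, HasDerivAt f (f' y) y) (df' : ∀ y, HasDerivAt f' (f'' y) y) (n : ℕ) :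
    gi (fun y => (f'' y - y / 2 * f' y) * He n y) = - (n / 2) * gi (fun y => f y * He n y) := by
  rw [gi_L hf' hf'' (He_CE n) (He_dCE n) df' (He_dy n)]
  have h := gi_L (He_dCE n) ((He_CE (n-2)).const_mul _ |>.const_mul _) hf hf' (He_ddy n) df
  have e : (fun y => (n * (((n - 1 : ℕ) : ℝ) * He (n - 2) y) - y / 2 * (n * He (n - 1) y)) * f y)
      = fun y => - (n / 2) * (f y * He n y) := by
    ext y; rw [He_L]; ring
  rw [e, gi_const_mul] at h
  rw [h]; congr 2; ext y; ring

lemma He_orth {m n : ℕ} (h : m ≠ n) : gi (fun y => He m y * He n y) = 0 := by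
  have h1 := gi_L_He (He_CE m) (He_dCE m) ((He_CE (m-2)).const_mul _ |>.const_mul _)
    (He_dy m) (He_ddy m) n
  have e : (fun y => (m * (((m - 1 : ℕ) : ℝ) * He (m - 2) y) - y / 2 * (m * He (m - 1) y)) * He n y)
      = fun y => - (m / 2) * (He m y * He n y) := by
    ext y; rw [He_L]; ring
  rw [e, gi_const_mul] at h1
  have h2 : ((m : ℝ) - n) * gi (fun y => He m y * He n y) = 0 := by linarith
  rcases mul_eq_zero.1 h2 with h3 | h3
  · exact absurd (by exact_mod_cast sub_eq_zero.1 h3) h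
  · exact h3

/-- solving `A^* φ = g` -/
lemma exists_phi {g : ℝ → ℝ} (hg : CE g) (h0 : gi g = 0) :
    ∃ φ φ' : ℝ → ℝ, CE φ ∧ CE φ' ∧ (∀ y, HasDerivAt φ (φ' y) y) ∧ ∀ y, y / 2 * φ y - φ' y = g y := by
  have hInteg := hg.int
  have hcont : Continuous (fun y => g y * GW y) := hg.1.mul GW_cont
  set Φ : ℝ → ℝ := fun y => ∫ z in Iic y, g z * GW z with hΦ
  have dΦ : ∀ y, HasDerivAt Φ (g y * GW y) y := by
    intro y
    have e : Φ = fun y => (∫ z in Iic (0:ℝ), g z * GW z) + ∫ z in (0:ℝ)..y, g z * GW z := by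
      ext y
      rw [← intervalIntegral.integral_Iic_sub_Iic hInteg.integrableOn hInteg.integrableOn]
      ring
    rw [e]
    exact ((hcont.integral_hasStrictDerivAt 0 y).hasDerivAt).const_add _
  have dE : ∀ y : ℝ, HasDerivAt (fun y : ℝ => Real.exp (y ^ 2 / 4)) (y / 2 * Real.exp (y ^ 2 / 4)) y := by
    intro y
    have := ((hasDerivAt_pow 2 y).div_const 4).exp
    exact hd this (fun y => rfl) (by norm_num; ring)
  have hEG : ∀ y : ℝ, Real.exp (y ^ 2 / 4) * GW y = 1 := by
    intro y; unfold GW; rw [← Real.exp_add]; simp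
  set φ : ℝ → ℝ := fun y => - (Real.exp (y ^ 2 / 4) * Φ y) with hφ
  have dφ : ∀ y, HasDerivAt φ (y / 2 * φ y - g y) y := by
    intro y
    have := ((dE y).mul (dΦ y)).neg
    refine hd this (fun y => rfl) ?_
    have := hEG y
    simp only [hφ]
    linear_combination (g y) * this
  have hφc : Continuous φ := continuous_iff_continuousAt.2 fun y => (dφ y).continuousAt
  obtain ⟨-, C, κ, hC, hκ, hb⟩ := id hg
  have hI := exp_abs_integrable κ (1/4) (by norm_num)
  set J := ∫ y : ℝ, Real.exp (κ * |y|) * Real.exp (-(1/4 * y ^ 2)) with hJ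
  have key : ∀ (y : ℝ) (S : Set ℝ), MeasurableSet S → (∀ z ∈ S, 0 ≤ y * (z - y)) →
      Real.exp (y ^ 2 / 4) * |∫ z in S, g z * GW z| ≤ C * J * Real.exp (κ * |y|) := by
    intro y S hS hz
    have hIy := (hI.comp_sub_right y).const_mul (C * Real.exp (κ * |y|))
    have : ‖∫ z in S, Real.exp (y ^ 2 / 4) * (g z * GW z)‖ ≤
        ∫ z in S, C * Real.exp (κ * |y|) * (Real.exp (κ * |z - y|) * Real.exp (-(1/4 * (z - y) ^ 2))) := by
      refine norm_integral_le_of_norm_le hIy.integrableOn ?_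
      refine (ae_restrict_iff' hS).2 (Eventually.of_forall fun z hzS => ?_)
      rw [Real.norm_eq_abs, abs_mul, abs_mul, abs_of_pos (Real.exp_pos _), abs_of_pos (GW_pos _)]
      have h1 : |g z| ≤ C * (Real.exp (κ * |y|) * Real.exp (κ * |z - y|)) := by
        refine (hb z).trans ?_
        rw [← Real.exp_add]
        gcongr
        have : |z| ≤ |y| + |z - y| := by
          calc |z| = |y + (z - y)| := by ring_nf
            _ ≤ _ := abs_add_le _ _
        nlinarith
      have h2 : Real.exp (y ^ 2 / 4) * GW z ≤ Real.exp (-(1/4 * (z - y) ^ 2)) := by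
        unfold GW
        rw [← Real.exp_add]
        apply Real.exp_le_exp.2
        nlinarith [hz z hzS]
      calc Real.exp (y ^ 2 / 4) * (|g z| * GW z) = |g z| * (Real.exp (y ^ 2 / 4) * GW z) := by ring
        _ ≤ (C * (Real.exp (κ * |y|) * Real.exp (κ * |z - y|))) * Real.exp (-(1/4 * (z - y) ^ 2)) :=
          mul_le_mul h1 h2 (mul_nonneg (Real.exp_pos _).le (GW_pos _).le) (by positivity)
        _ = _ := by ring
    rw [integral_const_mul, Real.norm_eq_abs, abs_mul, abs_of_pos (Real.exp_pos _)] at this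
    refine this.trans ?_
    calc _ ≤ ∫ z, C * Real.exp (κ * |y|) * (Real.exp (κ * |z - y|) * Real.exp (-(1/4 * (z - y) ^ 2))) :=
          setIntegral_le_integral hIy (Eventually.of_forall fun z => by positivity)
      _ = C * Real.exp (κ * |y|) * J := by
          rw [integral_const_mul, hJ]
          congr 1
          exact integral_sub_right_eq_self (fun z : ℝ => Real.exp (κ * |z|) * Real.exp (-(1/4 * z ^ 2))) y
      _ = _ := by ring
  have hJ0 : 0 ≤ J := integral_nonneg fun y => by positivity
  have hφCE : CE φ := by
    refine ⟨hφc, C * J, κ, by positivity, hκ, fun y => ?_⟩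
    simp only [hφ, abs_neg, abs_mul, abs_of_pos (Real.exp_pos _)]
    rcases le_total y 0 with hy | hy
    · exact key y (Iic y) measurableSet_Iic fun z hz => mul_nonneg_of_nonpos_of_nonpos hy (by simpa using hz)
    · have e : Φ y = - ∫ z in Ioi y, g z * GW z := by
        have := intervalIntegral.integral_Iic_add_Ioi (b := y) hInteg.integrableOn hInteg.integrableOn
        unfold gi at h0
        rw [h0] at this
        simp only [hΦ]; linarith
      rw [e, abs_neg]
      exact key y (Ioi y) measurableSet_Ioi fun z hz => mul_nonneg hy (by
        have : y < z := hz
        linarith)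
  exact ⟨φ, fun y => y / 2 * φ y - g y, hφCE, hφCE.half.sub hg, dφ, fun y => by ring⟩

/-- Higher Gaussian Poincaré inequality -/
lemma poincare (N : ℕ) : ∀ g g' : ℝ → ℝ, CE g → CE g' → (∀ y, HasDerivAt g (g' y) y) →
    (∀ k < N, gi (fun y => g y * He k y) = 0) →
    (N : ℝ) / 2 * gi (fun y => g y ^ 2) ≤ gi (fun y => g' y ^ 2) := by
  induction N with
  | zero => intro g g' _ _ _ _; simpa using gi_nonneg fun y => sq_nonneg (g' y)
  | succ N ih =>
    intro g g' hg hg' dg ho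
    have h0 : gi g = 0 := by
      have := ho 0 (by omega)
      simpa [He, HP] using this
    obtain ⟨φ, φ', hφ, hφ', dφ, heq⟩ := exists_phi hg h0
    have horth : ∀ k < N, gi (fun y => φ y * He k y) = 0 := by
      intro k hk
      have h1 := gi_ibp (He_CE (k+1)) (He_dCE (k+1)) hφ hφ' (He_dy (k+1)) dφ
      simp only [heq] at h1
      have h2 := ho (k+1) (by omega)
      have e2 : gi (fun y => He (k+1) y * g y) = 0 := by rw [← h2]; congr 1; ext y; ring
      rw [e2] at h1
      have e3 : (fun y => ((k + 1 : ℕ) : ℝ) * He (k + 1 - 1) y * φ y) =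
          fun y => ((k + 1 : ℕ) : ℝ) * (φ y * He k y) := by
        ext y; rw [Nat.add_sub_cancel]; ring
      rw [e3, gi_const_mul] at h1
      rcases mul_eq_zero.1 h1 with h | h
      · exfalso; have : k + 1 = 0 := by exact_mod_cast h
        omega
      · exact h
    have hP := ih φ φ' hφ hφ' dφ horth
    have hφ2 : CE (fun y => φ y ^ 2) := by simpa [sq] using hφ.mul hφ
    have hφ'2 : CE (fun y => φ' y ^ 2) := by simpa [sq] using hφ'.mul hφ'
    have hg2 : CE (fun y => g y ^ 2) := by simpa [sq] using hg.mul hg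
    have hg'2 : CE (fun y => g' y ^ 2) := by simpa [sq] using hg'.mul hg'
    -- ‖g‖² = ‖φ'‖² + ½ ‖φ‖²
    have hid : gi (fun y => g y ^ 2) = gi (fun y => φ' y ^ 2) + 1 / 2 * gi (fun y => φ y ^ 2) := by
      have dψ : ∀ y, HasDerivAt (fun y => y / 2 * φ y) (1 / 2 * φ y + y / 2 * φ' y) y := by
        intro y
        exact ((hasDerivAt_id y).div_const 2).mul (dφ y)
      have h1 := gi_ibp hφ hφ' hφ.half ((hφ.const_mul (1/2)).add hφ'.half) dφ dψ
      have A1 : CE (fun y => φ' y * (y / 2 * φ y)) := hφ'.mul hφ.half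
      have A2 : CE (fun y => φ y * (y / 2 * (y / 2 * φ y) - (1 / 2 * φ y + y / 2 * φ' y))) :=
        hφ.mul (hφ.half.half.sub ((hφ.const_mul (1/2)).add hφ'.half))
      have e : gi (fun y => g y ^ 2) = gi (fun y => (φ' y ^ 2 + 1 / 2 * φ y ^ 2) +
         (φ y * (y / 2 * (y / 2 * φ y) - (1 / 2 * φ y + y / 2 * φ' y)) - φ' y * (y / 2 * φ y))) := by
        congr 1; ext y; rw [← heq]; ring
      rw [e, gi_add (hφ'2.add (hφ2.const_mul _)) (A2.sub A1), gi_sub A2 A1, h1,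
        gi_add hφ'2 (hφ2.const_mul _), gi_const_mul]
      ring
    -- 2‖g‖² = 2⟨φ, g'⟩
    have hc : gi (fun y => g' y * φ y) = gi (fun y => g y ^ 2) := by
      have h1 := gi_ibp hg hg' hφ hφ' dg dφ
      simp only [heq] at h1
      rw [h1]; congr 1; ext y; ring
    have hN : (0:ℝ) < ((N:ℝ) + 1) / 2 := by positivity
    have hy : 2 * gi (fun y => g' y * φ y) ≤ (((N:ℝ) + 1) / 2) * gi (fun y => φ y ^ 2) +
        (((N:ℝ) + 1) / 2)⁻¹ * gi (fun y => g' y ^ 2) := by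
      rw [← gi_const_mul, ← gi_const_mul, ← gi_const_mul, ← gi_add (hφ2.const_mul _) (hg'2.const_mul _)]
      refine gi_mono ((hg'.mul hφ).const_mul _) ((hφ2.const_mul _).add (hg'2.const_mul _)) fun y => ?_
      rw [← sub_nonneg]
      have : ((N:ℝ) + 1) / 2 * φ y ^ 2 + (((N:ℝ) + 1) / 2)⁻¹ * g' y ^ 2 - 2 * (g' y * φ y)
        = (((N:ℝ) + 1) / 2)⁻¹ * (((N:ℝ) + 1) / 2 * φ y - g' y) ^ 2 := by
        field_simp; ring
      rw [this]; positivity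
    rw [hc] at hy
    have h3 : gi (fun y => g y ^ 2) ≤ (((N:ℝ) + 1) / 2)⁻¹ * gi (fun y => g' y ^ 2) := by linarith
    push_cast
    rw [inv_mul_eq_div, le_div_iff₀ hN] at h3
    linarith

end ZN


namespace ZN
open MeasureTheory Filter Topology

lemma CE.sq {f : ℝ → ℝ} (hf : CE f) : CE (fun y => f y ^ 2) := by
  simpa [pow_two] using hf.mul hf

lemma pointwise_bound {g g' : ℝ → ℝ} (hg : CE g) (hg' : CE g') (dg : ∀ y, HasDerivAt g (g' y) y)
    (y : ℝ) : g y ^ 2 ≤ 5 * (gi (fun y => g y ^ 2) + gi (fun y => g' y ^ 2)) * Real.exp (2 * y ^ 2 / 7) := by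
  set e : ℝ → ℝ := fun y => Real.exp (-(y ^ 2 / 28)) with he
  have de : ∀ y, HasDerivAt e (-(y / 14) * e y) y := by
    intro y
    have := ((hasDerivAt_pow 2 y).div_const 28).neg.exp
    exact hd this (fun y => rfl) (by simp only [Pi.neg_apply, he]; norm_num; ring)
  have hee : CE e := ⟨by simp only [he]; fun_prop, 1, 0, by norm_num, le_rfl, fun y => by
    simp only [he, abs_of_pos (Real.exp_pos _)]
    simp; positivity⟩
  have dF : ∀ y, HasDerivAt (fun y => g y ^ 2 * e y * GW y)
      ((2 * (g y * g' y) * e y - 4 / 7 * y * (g y ^ 2 * e y)) * GW y) y := by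
    intro y
    refine hd ((((dg y).pow 2).mul (de y)).mul (GW_deriv y)) (fun y => rfl) ?_
    simp only [Pi.mul_apply, Pi.pow_apply]
    push_cast
    ring
  have hF1 : CE (fun y => g y ^ 2 * e y) := hg.sq.mul hee
  have hF2 : CE (fun y => 2 * (g y * g' y) * e y - 4 / 7 * y * (g y ^ 2 * e y)) :=
    (((hg.mul hg').const_mul 2).mul hee).sub ((CE.id.const_mul (4/7)).mul hF1)
  have hlim := tendsto_zero_of_hasDerivAt_of_integrableOn_Iic (a := y) (fun x _ => dF x)
    hF2.int.integrableOn hF1.int.integrableOn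
  have hI := integral_Iic_of_hasDerivAt_of_tendsto' (a := y) (fun x _ => dF x) hF2.int.integrableOn hlim
  have hB : CE (fun y => 5 * (g y ^ 2 + g' y ^ 2)) := (hg.sq.add hg'.sq).const_mul 5
  have hle : ∀ z, ‖(2 * (g z * g' z) * e z - 4 / 7 * z * (g z ^ 2 * e z)) * GW z‖ ≤
      (5 * (g z ^ 2 + g' z ^ 2)) * GW z := by
    intro z
    rw [Real.norm_eq_abs, abs_mul, abs_of_pos (GW_pos z)]
    refine mul_le_mul_of_nonneg_right ?_ (GW_pos z).le
    have e1 : e z ≤ 1 := by simp only [he]; simp; positivity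
    have e0 : 0 < e z := Real.exp_pos _
    have e2 : 4 / 7 * |z| * e z ≤ 4 := by
      have h1 : 1 + z ^ 2 / 28 ≤ Real.exp (z ^ 2 / 28) := by linarith [Real.add_one_le_exp (z ^ 2 / 28)]
      have h2 : Real.exp (z ^ 2 / 28) * e z = 1 := by simp only [he]; rw [← Real.exp_add]; simp
      have h3 : 4 / 7 * |z| ≤ 4 * (1 + z ^ 2 / 28) := by
        rw [← sq_abs]; nlinarith [sq_nonneg (|z| - 2)]
      calc 4 / 7 * |z| * e z ≤ 4 * Real.exp (z ^ 2 / 28) * e z :=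
            mul_le_mul_of_nonneg_right (by linarith) e0.le
        _ = 4 := by rw [mul_assoc, h2]; norm_num
    have e3 : |2 * (g z * g' z) * e z| ≤ (g z ^ 2 + g' z ^ 2) := by
      rw [abs_mul, abs_of_pos e0]
      have : |2 * (g z * g' z)| ≤ g z ^ 2 + g' z ^ 2 := by
        rw [abs_le]; constructor <;> nlinarith [sq_nonneg (g z - g' z), sq_nonneg (g z + g' z)]
      calc _ ≤ (g z ^ 2 + g' z ^ 2) * 1 := mul_le_mul this e1 e0.le (by positivity)
        _ = _ := by ring
    have e4 : |4 / 7 * z * (g z ^ 2 * e z)| ≤ 4 * g z ^ 2 := by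
      rw [abs_mul, abs_mul, abs_mul, abs_of_pos e0, abs_of_nonneg (sq_nonneg (g z)), abs_of_pos (by norm_num : (0:ℝ) < 4/7)]
      calc 4 / 7 * |z| * (g z ^ 2 * e z) = (4 / 7 * |z| * e z) * g z ^ 2 := by ring
        _ ≤ _ := by gcongr
    calc _ ≤ _ := abs_sub _ _
      _ ≤ (g z ^ 2 + g' z ^ 2) + 4 * g z ^ 2 := add_le_add e3 e4
      _ ≤ _ := by nlinarith [sq_nonneg (g' z)]
  have h1 : g y ^ 2 * e y * GW y ≤ gi (fun y => 5 * (g y ^ 2 + g' y ^ 2)) := by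
    rw [sub_zero] at hI
    rw [← hI]
    refine (le_abs_self _).trans ?_
    rw [← Real.norm_eq_abs]
    refine (norm_integral_le_of_norm_le hB.int.integrableOn (Eventually.of_forall hle)).trans ?_
    exact setIntegral_le_integral hB.int (Eventually.of_forall fun z => by
      have := GW_pos z
      positivity)
  rw [gi_const_mul, gi_add hg.sq hg'.sq] at h1
  have h2 : e y * GW y * Real.exp (2 * y ^ 2 / 7) = 1 := by
    simp only [he, GW]; rw [← Real.exp_add, ← Real.exp_add, Real.exp_eq_one_iff]; ring
  calc g y ^ 2 = (g y ^ 2 * e y * GW y) * Real.exp (2 * y ^ 2 / 7) := by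
        linear_combination (- g y ^ 2) * h2
    _ ≤ _ := by gcongr

lemma approx (n N : ℕ) (hn : n < N) : ∃ Cst : ℝ, 0 ≤ Cst ∧ ∀ q : ℝ, 0 ≤ q → q + 3 / 2 ≤ (N : ℝ) / 2 →
    (∀ k : ℕ, k ≠ n → 1 / 8 ≤ |q - k / 2|) →
    ∀ f f' f'' : ℝ → ℝ, CE f → CE f' → CE f'' → (∀ y, HasDerivAt f (f' y) y) →
    (∀ y, HasDerivAt f' (f'' y) y) → ∀ ε : ℝ, 0 ≤ ε →
    gi (fun y => (f'' y - y / 2 * f' y + q * f y) ^ 2) ≤ ε ^ 2 →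
    ∃ c : ℝ, gi (fun y => f y ^ 2) ≤ c ^ 2 * gi (fun y => He n y ^ 2) + Cst * ε ^ 2 ∧
      ∀ y, |f y - c * He n y| ≤ Cst * ε * Real.exp (y ^ 2 / 7) := by
  have hHb : ∀ k, ∃ C : ℝ, 0 ≤ C ∧ ∀ y : ℝ, |He k y| ≤ C * Real.exp (y ^ 2 / 7) := by
    intro k
    obtain ⟨C, hC, h⟩ := HP_bound_gauss k
    exact ⟨C, hC, fun y => h (-1) y (by simp)⟩
  choose B hB0 hB using hHb
  set nk : ℕ → ℝ := fun k => gi (fun y => He k y ^ 2) with hnk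
  have hnkpos : ∀ k, 0 < nk k := He_norm_pos
  set C1 : ℝ := 1 / 2 + 64 * N with hC1
  set C2 : ℝ := Real.sqrt (5 * (N / 4 + 1)) + ∑ k ∈ (Finset.range N).erase n, 8 / Real.sqrt (nk k) * B k with hC2
  have hC2s : 0 ≤ ∑ k ∈ (Finset.range N).erase n, 8 / Real.sqrt (nk k) * B k :=
    Finset.sum_nonneg fun k _ => mul_nonneg (by positivity) (hB0 k)
  have hC10 : 0 ≤ C1 := by positivity
  have hC20 : 0 ≤ C2 := by positivity
  refine ⟨C1 + C2, by positivity, ?_⟩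
  intro q hq hqN hqk f f' f'' hf hf' hf'' df df' ε hε he
  set e : ℝ → ℝ := fun y => f'' y - y / 2 * f' y + q * f y with hedef
  have hLf : CE (fun y => f'' y - y / 2 * f' y) := hf''.sub hf'.half
  have heC : CE e := hLf.add (hf.const_mul q)
  set c : ℕ → ℝ := fun k => gi (fun y => f y * He k y) / nk k with hc
  have hcn : ∀ k, gi (fun y => f y * He k y) = c k * nk k := fun k => by
    simp only [hc]; rw [div_mul_cancel₀ _ (hnkpos k).ne']
  set g : ℝ → ℝ := fun y => f y - ∑ k ∈ Finset.range N, c k * He k y with hgdef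
  set g' : ℝ → ℝ := fun y => f' y - ∑ k ∈ Finset.range N, c k * (k * He (k - 1) y) with hg'def
  set g'' : ℝ → ℝ := fun y => f'' y - ∑ k ∈ Finset.range N, c k * (k * (((k - 1 : ℕ) : ℝ) * He (k - 2) y)) with hg''def
  have hg : CE g := hf.sub (CE.sum _ fun k _ => (He_CE k).const_mul _)
  have hg' : CE g' := hf'.sub (CE.sum _ fun k _ => (He_dCE k).const_mul _)
  have hg'' : CE g'' := hf''.sub (CE.sum _ fun k _ => (((He_CE (k-2)).const_mul _).const_mul _).const_mul _)
  have dg : ∀ y, HasDerivAt g (g' y) y := fun y =>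
    (df y).sub (HasDerivAt.fun_sum fun k _ => (He_dy k y).const_mul _)
  have dg' : ∀ y, HasDerivAt g' (g'' y) y := fun y =>
    (df' y).sub (HasDerivAt.fun_sum fun k _ => (He_ddy k y).const_mul _)
  -- orthogonality
  have horth : ∀ k < N, gi (fun y => g y * He k y) = 0 := by
    intro k hk
    have e1 : (fun y => g y * He k y) = fun y => f y * He k y -
        ∑ j ∈ Finset.range N, c j * (He j y * He k y) := by
      ext y; simp only [hgdef]; rw [sub_mul, Finset.sum_mul]
      congr 1; refine Finset.sum_congr rfl fun j _ => ?_; ring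
    rw [e1, gi_sub (hf.mul (He_CE k)) (CE.sum _ fun j _ => ((He_CE j).mul (He_CE k)).const_mul _),
      gi_sum _ fun j _ => ((He_CE j).mul (He_CE k)).const_mul _]
    rw [Finset.sum_eq_single k]
    · rw [gi_const_mul, hcn k]
      have : gi (fun y => He k y * He k y) = nk k := by
        simp only [hnk]; congr 1; ext y; ring
      rw [this]; ring
    · intro j _ hj
      rw [gi_const_mul, He_orth hj, mul_zero]
    · intro h; exact absurd (Finset.mem_range.2 hk) h
  have horth' : ∀ (a : ℕ → ℝ), gi (fun y => (∑ k ∈ Finset.range N, a k * He k y) * g y) = 0 := by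
    intro a
    have e1 : (fun y => (∑ k ∈ Finset.range N, a k * He k y) * g y) =
        fun y => ∑ k ∈ Finset.range N, a k * (g y * He k y) := by
      ext y; rw [Finset.sum_mul]; refine Finset.sum_congr rfl fun j _ => ?_; ring
    rw [e1, gi_sum _ fun j _ => (hg.mul (He_CE j)).const_mul _]
    refine Finset.sum_eq_zero fun k hk => ?_
    rw [gi_const_mul, horth k (Finset.mem_range.1 hk), mul_zero]
  have hsumCE : ∀ (a : ℕ → ℝ), CE (fun y => ∑ k ∈ Finset.range N, a k * He k y) := fun a =>
    CE.sum _ fun k _ => (He_CE k).const_mul _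
  have hck : ∀ k, k ≠ n → c k ^ 2 * nk k ≤ 64 * ε ^ 2 := by
    intro k hk
    have h1 : gi (fun y => e y * He k y) = (q - k / 2) * (c k * nk k) := by
      have e1 : (fun y => e y * He k y) = fun y => (f'' y - y / 2 * f' y) * He k y + q * (f y * He k y) := by
        ext y; simp only [hedef]; ring
      rw [e1, gi_add (hLf.mul (He_CE k)) ((hf.mul (He_CE k)).const_mul _), gi_const_mul,
        gi_L_He hf hf' hf'' df df', hcn]
      ring
    have h2 := gi_cs heC (He_CE k)
    rw [h1] at h2
    have h3 : 1 / 64 ≤ (q - k / 2) ^ 2 := by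
      rw [← sq_abs]
      nlinarith [hqk k hk]
    have h4 : ((q - k / 2) * (c k * nk k)) ^ 2 ≤ ε ^ 2 * nk k :=
      h2.trans (mul_le_mul_of_nonneg_right he (hnkpos k).le)
    have h5 : (q - k / 2) ^ 2 * (c k ^ 2 * nk k) ≤ ε ^ 2 := by
      have : ((q - k / 2) ^ 2 * (c k ^ 2 * nk k)) * nk k ≤ ε ^ 2 * nk k := by
        calc _ = ((q - k / 2) * (c k * nk k)) ^ 2 := by ring
          _ ≤ _ := h4
      exact le_of_mul_le_mul_right this (hnkpos k)
    have h6 : 0 ≤ c k ^ 2 * nk k := mul_nonneg (sq_nonneg _) (hnkpos k).le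
    nlinarith
  -- e against g
  have heg : gi (fun y => e y * g y) = - gi (fun y => g' y ^ 2) + q * gi (fun y => g y ^ 2) := by
    have e1 : (fun y => e y * g y) = fun y => ((g'' y - y / 2 * g' y) * g y + q * g y ^ 2) +
        (∑ k ∈ Finset.range N, (c k * (q - k / 2)) * He k y) * g y := by
      ext y
      have : (∑ k ∈ Finset.range N, (c k * (q - k / 2)) * He k y) =
        (∑ k ∈ Finset.range N, c k * (k * (((k - 1 : ℕ) : ℝ) * He (k - 2) y))) -
          y / 2 * (∑ k ∈ Finset.range N, c k * (k * He (k - 1) y)) +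
          q * ∑ k ∈ Finset.range N, c k * He k y := by
        rw [Finset.mul_sum, Finset.mul_sum, ← Finset.sum_sub_distrib, ← Finset.sum_add_distrib]
        refine Finset.sum_congr rfl fun k _ => ?_
        have := He_L k y
        linear_combination (- c k) * this
      rw [this]
      simp only [hedef, hg''def, hg'def, hgdef]
      ring
    have hA : CE (fun y => (g'' y - y / 2 * g' y) * g y) := (hg''.sub hg'.half).mul hg
    rw [e1, gi_add (hA.add (hg.sq.const_mul _)) ((hsumCE _).mul hg), horth', gi_add hA (hg.sq.const_mul _),
      gi_const_mul, gi_L hg' hg'' hg hg' dg' dg, add_zero]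
    congr 3; ext y; ring
  have hegb : 2 * |gi (fun y => e y * g y)| ≤ ε ^ 2 + gi (fun y => g y ^ 2) := by
    have h1 : 0 ≤ gi (fun y => (e y + g y) ^ 2) := gi_nonneg fun y => sq_nonneg _
    have h2 : 0 ≤ gi (fun y => (e y - g y) ^ 2) := gi_nonneg fun y => sq_nonneg _
    have e1 : gi (fun y => (e y + g y) ^ 2) = gi (fun y => e y ^ 2) + gi (fun y => g y ^ 2) + 2 * gi (fun y => e y * g y) := by
      rw [← gi_const_mul, ← gi_add heC.sq hg.sq, ← gi_add (heC.sq.add hg.sq) ((heC.mul hg).const_mul _)]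
      congr 1; ext y; ring
    have e2 : gi (fun y => (e y - g y) ^ 2) = gi (fun y => e y ^ 2) + gi (fun y => g y ^ 2) - 2 * gi (fun y => e y * g y) := by
      rw [← gi_const_mul, ← gi_add heC.sq hg.sq, ← gi_sub (heC.sq.add hg.sq) ((heC.mul hg).const_mul _)]
      congr 1; ext y; ring
    rcases abs_cases (gi (fun y => e y * g y)) with ⟨h, _⟩ | ⟨h, _⟩ <;> rw [h] <;> linarith
  have hP := poincare N g g' hg hg' dg horth
  have hgn : 0 ≤ gi (fun y => g y ^ 2) := gi_nonneg fun y => sq_nonneg _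
  have habs := neg_abs_le (gi (fun y => e y * g y))
  have hg1 : gi (fun y => g y ^ 2) ≤ 1 / 2 * ε ^ 2 := by
    nlinarith
  have hD1 : gi (fun y => g' y ^ 2) ≤ (N / 4 + 1 / 2) * ε ^ 2 := by
    have h1 : gi (fun y => g' y ^ 2) ≤ q * gi (fun y => g y ^ 2) + 1 / 2 * (ε ^ 2 + gi (fun y => g y ^ 2)) := by linarith
    have h2 : (q + 1 / 2) * gi (fun y => g y ^ 2) ≤ (N / 2 - 1) * (1 / 2 * ε ^ 2) :=
      mul_le_mul (by linarith) hg1 hgn (by linarith)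
    nlinarith
  have hfsum : gi (fun y => f y ^ 2) = gi (fun y => g y ^ 2) + ∑ k ∈ Finset.range N, c k ^ 2 * nk k := by
    have e1 : (fun y => f y ^ 2) = fun y => (g y ^ 2 + (∑ k ∈ Finset.range N, c k * He k y) * g y) +
        ∑ k ∈ Finset.range N, c k * (f y * He k y) := by
      ext y
      have : ∑ k ∈ Finset.range N, c k * (f y * He k y) = f y * ∑ k ∈ Finset.range N, c k * He k y := by
        rw [Finset.mul_sum]; refine Finset.sum_congr rfl fun k _ => ?_; ring
      rw [this]; simp only [hgdef]; ring
    rw [e1, gi_add (hg.sq.add ((hsumCE _).mul hg)) (CE.sum _ fun k _ => (hf.mul (He_CE k)).const_mul _),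
      gi_add hg.sq ((hsumCE _).mul hg), horth', gi_sum _ fun k _ => (hf.mul (He_CE k)).const_mul _]
    rw [add_zero]; congr 1
    refine Finset.sum_congr rfl fun k _ => ?_
    rw [gi_const_mul, hcn]; ring
  refine ⟨c n, ?_, fun y => ?_⟩
  · rw [hfsum, ← Finset.add_sum_erase _ _ (Finset.mem_range.2 hn)]
    have h1 : ∑ k ∈ (Finset.range N).erase n, c k ^ 2 * nk k ≤ N * (64 * ε ^ 2) := by
      calc _ ≤ ∑ k ∈ (Finset.range N).erase n, 64 * ε ^ 2 :=
            Finset.sum_le_sum fun k hk => hck k (Finset.ne_of_mem_erase hk)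
        _ ≤ ∑ k ∈ (Finset.range N), 64 * ε ^ 2 :=
            Finset.sum_le_sum_of_subset_of_nonneg (Finset.erase_subset _ _) fun k _ _ => by positivity
        _ = _ := by simp
    have h2 : 0 ≤ C2 * ε ^ 2 := by positivity
    have h3 : C1 * ε ^ 2 = 1 / 2 * ε ^ 2 + N * (64 * ε ^ 2) := by simp only [hC1]; ring
    simp only [hnk] at h1 ⊢
    linarith
  · have e1 : f y - c n * He n y = g y + ∑ k ∈ (Finset.range N).erase n, c k * He k y := by
      simp only [hgdef]
      rw [← Finset.add_sum_erase _ _ (Finset.mem_range.2 hn)]; ring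
    have h1 : |g y| ≤ Real.sqrt (5 * (N / 4 + 1)) * ε * Real.exp (y ^ 2 / 7) := by
      apply abs_le_of_sq_le_sq _ (by positivity)
      refine (pointwise_bound hg hg' dg y).trans ?_
      rw [mul_pow, mul_pow, Real.sq_sqrt (by positivity), ← Real.exp_nat_mul]
      have : ((2:ℕ):ℝ) * (y ^ 2 / 7) = 2 * y ^ 2 / 7 := by push_cast; ring
      rw [this]
      gcongr ?_ * _
      nlinarith
    have h2 : ∀ k ∈ (Finset.range N).erase n, |c k * He k y| ≤
        8 / Real.sqrt (nk k) * B k * (ε * Real.exp (y ^ 2 / 7)) := by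
      intro k hk
      have hk' := hck k (Finset.ne_of_mem_erase hk)
      have h3 : |c k| ≤ 8 / Real.sqrt (nk k) * ε := by
        apply abs_le_of_sq_le_sq _ (by positivity)
        have h4 : (8 / Real.sqrt (nk k) * ε) ^ 2 = 64 * ε ^ 2 / nk k := by
          rw [mul_pow, div_pow, Real.sq_sqrt (hnkpos k).le]; ring
        rw [h4, le_div_iff₀ (hnkpos k)]
        exact hk'
      rw [abs_mul]
      calc _ ≤ (8 / Real.sqrt (nk k) * ε) * (B k * Real.exp (y ^ 2 / 7)) :=
            mul_le_mul h3 (hB k y) (abs_nonneg _) (by positivity)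
        _ = _ := by ring
    rw [e1]
    calc _ ≤ |g y| + ∑ k ∈ (Finset.range N).erase n, |c k * He k y| :=
          (abs_add_le _ _).trans (add_le_add le_rfl (Finset.abs_sum_le_sum_abs _ _))
      _ ≤ Real.sqrt (5 * (N / 4 + 1)) * ε * Real.exp (y ^ 2 / 7) +
          ∑ k ∈ (Finset.range N).erase n, 8 / Real.sqrt (nk k) * B k * (ε * Real.exp (y ^ 2 / 7)) :=
          add_le_add h1 (Finset.sum_le_sum h2)
      _ = C2 * ε * Real.exp (y ^ 2 / 7) := by rw [← Finset.sum_mul]; simp only [hC2]; ring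
      _ ≤ _ := by gcongr; linarith

end ZN

namespace ZN
open MeasureTheory Filter Topology

/-- Ornstein-Uhlenbeck type evolution in self-similar variables -/
structure OU (w ws w1 w2 : ℝ → ℝ → ℝ) (S0 C M : ℝ) : Prop where
  hC : 0 ≤ C
  hM : 0 ≤ M
  ds : ∀ s y, S0 < s → HasDerivAt (fun s => w s y) (ws s y) s
  d1 : ∀ s y, S0 < s → HasDerivAt (fun y => w s y) (w1 s y) y
  d2 : ∀ s y, S0 < s → HasDerivAt (fun y => w1 s y) (w2 s y) y
  cs : ∀ s, S0 < s → Continuous (ws s)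
  c2 : ∀ s, S0 < s → Continuous (w2 s)
  k1 : ∀ s y, S0 < s → ContinuousAt (fun s => w1 s y) s
  k2 : ∀ s y, S0 < s → ContinuousAt (fun s => w2 s y) s
  b0 : ∀ s y, S0 < s → |w s y| ≤ C
  b1 : ∀ s y, S0 < s → |w1 s y| ≤ C
  b2 : ∀ s y, S0 < s → |w2 s y| ≤ C
  bs : ∀ s y, S0 < s → |ws s y| ≤ C * (1 + |y|)
  eq : ∀ s y, S0 < s → |ws s y - (w2 s y - y / 2 * w1 s y)| ≤
    M * Real.exp (-s / 2) * (|w1 s y| + |w s y|)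
  nz : ∀ s, S0 < s → ∃ y, w s y ≠ 0

lemma CE.of_bdd {f : ℝ → ℝ} (hf : Continuous f) {C : ℝ} (hC : 0 ≤ C) (h : ∀ y, |f y| ≤ C) : CE f :=
  ⟨hf, C, 0, hC, le_rfl, fun y => by simpa using h y⟩

lemma CE.of_lin {f : ℝ → ℝ} (hf : Continuous f) {C : ℝ} (hC : 0 ≤ C) (h : ∀ y, |f y| ≤ C * (1 + |y|)) :
    CE f :=
  ⟨hf, C, 1, hC, zero_le_one, fun y => (h y).trans (by
    gcongr; have := Real.add_one_le_exp |y|; simp; linarith)⟩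

section
variable {w ws w1 w2 : ℝ → ℝ → ℝ} {S0 C M : ℝ}

lemma OU.w_CE (h : OU w ws w1 w2 S0 C M) {s : ℝ} (hs : S0 < s) : CE (w s) :=
  CE.of_bdd (continuous_iff_continuousAt.2 fun y => (h.d1 s y hs).continuousAt) h.hC (fun y => h.b0 s y hs)
lemma OU.w1_CE (h : OU w ws w1 w2 S0 C M) {s : ℝ} (hs : S0 < s) : CE (w1 s) :=
  CE.of_bdd (continuous_iff_continuousAt.2 fun y => (h.d2 s y hs).continuousAt) h.hC (fun y => h.b1 s y hs)
lemma OU.w2_CE (h : OU w ws w1 w2 S0 C M) {s : ℝ} (hs : S0 < s) : CE (w2 s) :=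
  CE.of_bdd (h.c2 s hs) h.hC (fun y => h.b2 s y hs)
lemma OU.ws_CE (h : OU w ws w1 w2 S0 C M) {s : ℝ} (hs : S0 < s) : CE (ws s) :=
  CE.of_lin (h.cs s hs) h.hC (fun y => h.bs s y hs)

lemma OU.L_CE (h : OU w ws w1 w2 S0 C M) {s : ℝ} (hs : S0 < s) :
    CE (fun y => w2 s y - y / 2 * w1 s y) := (h.w2_CE hs).sub (h.w1_CE hs).half

lemma OU.dI (h : OU w ws w1 w2 S0 C M) {s : ℝ} (hs : S0 < s) :
    HasDerivAt (fun s => gi (fun y => w s y ^ 2)) (2 * gi (fun y => ws s y * w s y)) s := by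
  have hb : CE (fun y => 2 * (C * (1 + |y|) * C)) :=
    CE.of_lin (C := 2 * C ^ 2) (by fun_prop) (by positivity) (fun y => by
      rw [abs_of_nonneg (by have := h.hC; positivity)]; apply le_of_eq; ring)
  have key := hasDerivAt_integral_of_dominated_loc_of_deriv_le (𝕜 := ℝ) (μ := volume)
    (F := fun s y => w s y ^ 2 * GW y) (F' := fun s y => 2 * (ws s y * w s y) * GW y) (x₀ := s)
    (s := Ioi S0) (bound := fun y => 2 * (C * (1 + |y|) * C) * GW y) (Ioi_mem_nhds hs) ?_ ?_ ?_ ?_ ?_ ?_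
  · refine hd key.2 (fun y => rfl) ?_
    rw [← gi_const_mul]; rfl
  · filter_upwards [Ioi_mem_nhds hs] with s' hs'
    exact (((h.w_CE hs').1.pow 2).mul GW_cont).aestronglyMeasurable
  · exact (h.w_CE hs).sq.int
  · exact ((((h.ws_CE hs).1.mul (h.w_CE hs).1).const_mul 2).mul GW_cont).aestronglyMeasurable
  · refine Eventually.of_forall fun y s' hs' => ?_
    rw [Real.norm_eq_abs, abs_mul, abs_of_pos (GW_pos y)]
    refine mul_le_mul_of_nonneg_right ?_ (GW_pos y).le
    rw [abs_mul, abs_mul, abs_two]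
    have := h.hC
    gcongr
    · exact h.bs s' y hs'
    · exact h.b0 s' y hs'
  · exact hb.int
  · refine Eventually.of_forall fun y s' hs' => ?_
    exact hd (((h.ds s' y hs').mul (h.ds s' y hs')).mul_const (GW y)) (fun y => by simp [sq]) (by ring)

lemma OU.symm_id (h : OU w ws w1 w2 S0 C M) {s t : ℝ} (hs : S0 < s) (ht : S0 < t) :
    gi (fun y => w1 t y ^ 2) - gi (fun y => w1 s y ^ 2) =
    - gi (fun y => (w t y - w s y) * ((w2 t y - y / 2 * w1 t y) + (w2 s y - y / 2 * w1 s y))) := by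
  have hd1 : CE (fun y => w1 t y - w1 s y) := (h.w1_CE ht).sub (h.w1_CE hs)
  have hd0 : CE (fun y => w t y - w s y) := (h.w_CE ht).sub (h.w_CE hs)
  have e1 := gi_L (h.w1_CE ht) (h.w2_CE ht) hd0 hd1 (fun y => h.d2 t y ht)
    (fun y => (h.d1 t y ht).sub (h.d1 s y hs))
  have e2 := gi_L (h.w1_CE hs) (h.w2_CE hs) hd0 hd1 (fun y => h.d2 s y hs)
    (fun y => (h.d1 t y ht).sub (h.d1 s y hs))
  have e3 := gi_add ((h.L_CE ht).mul hd0) ((h.L_CE hs).mul hd0)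
  have e4 := gi_add ((h.w1_CE ht).mul hd1) ((h.w1_CE hs).mul hd1)
  have e5 := gi_sub (h.w1_CE ht).sq (h.w1_CE hs).sq
  have e6 : gi (fun y => (w t y - w s y) * ((w2 t y - y / 2 * w1 t y) + (w2 s y - y / 2 * w1 s y))) =
    gi (fun y => (w2 t y - y / 2 * w1 t y) * (w t y - w s y) + (w2 s y - y / 2 * w1 s y) * (w t y - w s y)) := by
    congr 1; ext y; ring
  have e7 : gi (fun y => w1 t y ^ 2 - w1 s y ^ 2) =
    gi (fun y => w1 t y * (w1 t y - w1 s y) + w1 s y * (w1 t y - w1 s y)) := by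
    congr 1; ext y; ring
  rw [e6, e3, e1, e2, ← e5, e7, e4]; ring

lemma OU.dD (h : OU w ws w1 w2 S0 C M) {s : ℝ} (hs : S0 < s) :
    HasDerivAt (fun s => gi (fun y => w1 s y ^ 2))
      (-2 * gi (fun y => ws s y * (w2 s y - y / 2 * w1 s y))) s := by
  rw [hasDerivAt_iff_tendsto_slope]
  have hC := h.hC
  have hb : CE (fun y => (C * (1 + |y|)) * (2 * (C * (1 + |y|)))) := by
    have : CE (fun y => C * (1 + |y|)) := CE.of_lin (C := C) (by fun_prop) hC (fun y => by
      rw [abs_of_nonneg (by positivity)])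
    exact this.mul (this.const_mul 2)
  have hLb : ∀ t y, S0 < t → |w2 t y - y / 2 * w1 t y| ≤ C * (1 + |y|) := by
    intro t y ht
    have h1 : |y / 2 * w1 t y| ≤ |y| * C := by
      rw [abs_mul]
      have : |y / 2| ≤ |y| := by rw [abs_div, abs_two]; linarith [abs_nonneg y]
      exact mul_le_mul this (h.b1 t y ht) (abs_nonneg _) (abs_nonneg _)
    have := abs_sub (w2 t y) (y / 2 * w1 t y)
    have := h.b2 t y ht
    linarith
  have key : Tendsto (fun t => ∫ y, ((t - s)⁻¹ * (w t y - w s y)) *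
      ((w2 t y - y / 2 * w1 t y) + (w2 s y - y / 2 * w1 s y)) * GW y) (𝓝[≠] s)
      (𝓝 (∫ y, ws s y * ((w2 s y - y / 2 * w1 s y) + (w2 s y - y / 2 * w1 s y)) * GW y)) := by
    apply tendsto_integral_filter_of_dominated_convergence
      (fun y => (C * (1 + |y|)) * (2 * (C * (1 + |y|))) * GW y)
    · filter_upwards [mem_nhdsWithin_of_mem_nhds (Ioi_mem_nhds hs)] with t ht
      exact (((((h.w_CE ht).1.sub (h.w_CE hs).1).const_mul _).mul
        ((h.L_CE ht).1.add (h.L_CE hs).1)).mul GW_cont).aestronglyMeasurable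
    · filter_upwards [mem_nhdsWithin_of_mem_nhds (Ioi_mem_nhds hs), self_mem_nhdsWithin] with t ht htne
      refine Eventually.of_forall fun y => ?_
      rw [Real.norm_eq_abs, abs_mul, abs_of_pos (GW_pos y)]
      refine mul_le_mul_of_nonneg_right ?_ (GW_pos y).le
      rw [abs_mul]
      refine mul_le_mul ?_ ?_ (abs_nonneg _) (by positivity)
      · have := (convex_Ioi S0).norm_image_sub_le_of_norm_hasDerivWithin_le (f := fun s => w s y)
          (f' := fun s => ws s y) (C := C * (1 + |y|))
          (fun x hx => (h.ds x y hx).hasDerivWithinAt) (fun x hx => h.bs x y hx) hs ht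
        have hne : 0 < |t - s| := abs_pos.2 (sub_ne_zero.2 htne)
        rw [abs_mul, abs_inv, inv_mul_le_iff₀ hne, mul_comm]
        exact this
      · have := abs_add_le (w2 t y - y / 2 * w1 t y) (w2 s y - y / 2 * w1 s y)
        linarith [hLb t y ht, hLb s y hs]
    · exact hb.int
    · refine Eventually.of_forall fun y => ?_
      refine Tendsto.mul (Tendsto.mul ?_ ?_) tendsto_const_nhds
      · have := hasDerivAt_iff_tendsto_slope.1 (h.ds s y hs)
        refine this.congr fun t => ?_
        rw [slope_def_field, div_eq_inv_mul]
      · refine Tendsto.mono_left ?_ nhdsWithin_le_nhds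
        have e1 := h.k1 s y hs
        have e2 := h.k2 s y hs
        have : ContinuousAt (fun t => (w2 t y - y / 2 * w1 t y) + (w2 s y - y / 2 * w1 s y)) s := by fun_prop
        exact this
  have key2 := key.neg
  have e : -2 * gi (fun y => ws s y * (w2 s y - y / 2 * w1 s y)) =
    - ∫ y, ws s y * ((w2 s y - y / 2 * w1 s y) + (w2 s y - y / 2 * w1 s y)) * GW y := by
    have : gi (fun y => 2 * (ws s y * (w2 s y - y / 2 * w1 s y))) = ∫ y, ws s y * ((w2 s y - y / 2 * w1 s y) + (w2 s y - y / 2 * w1 s y)) * GW y := by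
      unfold gi; congr 1; ext y; ring
    rw [← this, gi_const_mul]; ring
  rw [e]
  refine key2.congr' ?_
  filter_upwards [mem_nhdsWithin_of_mem_nhds (Ioi_mem_nhds hs)] with t ht
  rw [slope_def_field, h.symm_id hs ht]
  have : gi (fun y => (t - s)⁻¹ * ((w t y - w s y) * ((w2 t y - y / 2 * w1 t y) + (w2 s y - y / 2 * w1 s y)))) =
    ∫ y, ((t - s)⁻¹ * (w t y - w s y)) *
      ((w2 t y - y / 2 * w1 t y) + (w2 s y - y / 2 * w1 s y)) * GW y := by
    unfold gi; congr 1; ext y; ring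
  rw [← this, gi_const_mul]; ring

end
end ZN

namespace ZN
open MeasureTheory Filter Topology

section
variable {w ws w1 w2 : ℝ → ℝ → ℝ} {S0 C M : ℝ}

/-- the frequency -/
noncomputable def fq (w w1 : ℝ → ℝ → ℝ) (s : ℝ) : ℝ :=
  gi (fun y => w1 s y ^ 2) / gi (fun y => w s y ^ 2)

lemma OU.I_pos (h : OU w ws w1 w2 S0 C M) {s : ℝ} (hs : S0 < s) : 0 < gi (fun y => w s y ^ 2) := by
  obtain ⟨y, hy⟩ := h.nz s hs
  exact gi_pos (h.w_CE hs).sq (fun y => sq_nonneg _) y (pow_ne_zero 2 hy)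

lemma fq_nonneg (s : ℝ) : 0 ≤ fq w w1 s :=
  div_nonneg (gi_nonneg fun y => sq_nonneg _) (gi_nonneg fun y => sq_nonneg _)

lemma OU.dF (h : OU w ws w1 w2 S0 C M) {s : ℝ} (hs : S0 < s) :
    ∃ F' : ℝ, HasDerivAt (fun s => (1 + fq w w1 s) * Real.exp (2 * M ^ 2 * Real.exp (-s))) F' s ∧
    F' ≤ - (gi (fun y => (w2 s y - y / 2 * w1 s y + fq w w1 s * w s y) ^ 2) / gi (fun y => w s y ^ 2)) := by
  set q := fq w w1 s with hq
  set I := gi (fun y => w s y ^ 2) with hI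
  set D := gi (fun y => w1 s y ^ 2) with hD
  have hIpos : 0 < I := h.I_pos hs
  have hqI : q * I = D := by rw [hq, fq, div_mul_cancel₀ _ hIpos.ne']
  have hq0 : 0 ≤ q := fq_nonneg s
  set e : ℝ → ℝ := fun y => w2 s y - y / 2 * w1 s y + q * w s y with he
  have heCE : CE e := (h.L_CE hs).add ((h.w_CE hs).const_mul q)
  set ECE := (h.ws_CE hs).sub (h.L_CE hs)
  set EE : ℝ → ℝ := fun y => ws s y - (w2 s y - y / 2 * w1 s y) with hEE
  -- derivative of the frequency
  have dq : HasDerivAt (fq w w1) ((-2 * gi (fun y => ws s y * (w2 s y - y / 2 * w1 s y)) * I -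
      D * (2 * gi (fun y => ws s y * w s y))) / I ^ 2) s := (h.dD hs).div (h.dI hs) hIpos.ne'
  set q' := (-2 * gi (fun y => ws s y * (w2 s y - y / 2 * w1 s y)) * I -
      D * (2 * gi (fun y => ws s y * w s y))) / I ^ 2 with hq'
  have hwe : gi (fun y => w s y * e y) = 0 := by
    have e1 := gi_L (h.w1_CE hs) (h.w2_CE hs) (h.w_CE hs) (h.w1_CE hs) (fun y => h.d2 s y hs)
      (fun y => h.d1 s y hs)
    have e2 := gi_add ((h.L_CE hs).mul (h.w_CE hs)) ((h.w_CE hs).sq.const_mul q)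
    rw [e1, gi_const_mul] at e2
    have e3 : gi (fun y => w s y * e y) = gi (fun y => (w2 s y - y / 2 * w1 s y) * w s y + q * w s y ^ 2) := by
      congr 1; ext y; simp only [he]; ring
    have e4 : gi (fun y => w1 s y * w1 s y) = D := by rw [hD]; congr 1; ext y; ring
    rw [e3, e2, e4]; linarith
  have hq'I : q' * I = gi (fun y => -2 * (ws s y * e y)) := by
    have e1 := gi_add ((h.ws_CE hs).mul (h.L_CE hs)) (((h.ws_CE hs).mul (h.w_CE hs)).const_mul q)
    have e2 : gi (fun y => ws s y * e y) = gi (fun y => ws s y * (w2 s y - y / 2 * w1 s y) + q * (ws s y * w s y)) := by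
      congr 1; ext y; simp only [he]; ring
    rw [gi_const_mul, e2, e1, gi_const_mul, hq']
    field_simp
    rw [← hqI]; ring
  have hEb : gi (fun y => EE y ^ 2) ≤ 2 * M ^ 2 * Real.exp (-s) * (D + I) := by
    have e1 := gi_add (h.w1_CE hs).sq (h.w_CE hs).sq
    rw [← e1, ← gi_const_mul]
    refine gi_mono ECE.sq (((h.w1_CE hs).sq.add (h.w_CE hs).sq).const_mul _) fun y => ?_
    have h1 := h.eq s y hs
    have h2 : EE y ^ 2 ≤ (M * Real.exp (-s / 2) * (|w1 s y| + |w s y|)) ^ 2 := by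
      rw [← sq_abs (EE y)]; exact pow_le_pow_left₀ (abs_nonneg _) h1 2
    have h3 : Real.exp (-s / 2) ^ 2 = Real.exp (-s) := by
      rw [← Real.exp_nat_mul]; congr 1; push_cast; ring
    have h4 : (|w1 s y| + |w s y|) ^ 2 ≤ 2 * (w1 s y ^ 2 + w s y ^ 2) := by
      rw [← sq_abs (w1 s y), ← sq_abs (w s y)]; nlinarith [sq_nonneg (|w1 s y| - |w s y|)]
    calc _ ≤ _ := h2
      _ = M ^ 2 * Real.exp (-s) * (|w1 s y| + |w s y|) ^ 2 := by rw [mul_pow, mul_pow, h3]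
      _ ≤ M ^ 2 * Real.exp (-s) * (2 * (w1 s y ^ 2 + w s y ^ 2)) := by gcongr
      _ = _ := by ring
  have hmain : q' * I ≤ - gi (fun y => e y ^ 2) + 2 * M ^ 2 * Real.exp (-s) * (D + I) := by
    have hwe' := (h.w_CE hs).mul heCE
    have e1 := gi_sub (ECE.sq.add (hwe'.const_mul (2 * q))) heCE.sq
    rw [gi_add ECE.sq (hwe'.const_mul (2 * q)), gi_const_mul, hwe] at e1
    have e2 := gi_mono (((h.ws_CE hs).mul heCE).const_mul (-2)) ((ECE.sq.add (hwe'.const_mul (2 * q))).sub heCE.sq)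
      (fun y => by
        have : ws s y = EE y + e y - q * w s y := by simp only [hEE, he]; ring
        have e3 : -2 * (ws s y * e y) = -2 * e y ^ 2 - 2 * (EE y * e y) + 2 * q * (w s y * e y) := by rw [this]; ring
        show -2 * (ws s y * e y) ≤ EE y ^ 2 + 2 * q * (w s y * e y) - e y ^ 2
        rw [e3]; nlinarith [sq_nonneg (EE y + e y)])
    rw [e1, ← hq'I] at e2
    have : gi (fun y => (ws s y - (w2 s y - y / 2 * w1 s y)) ^ 2) = gi (fun y => EE y ^ 2) := rfl
    linarith
  set G := Real.exp (2 * M ^ 2 * Real.exp (-s)) with hG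
  have dG : HasDerivAt (fun s => Real.exp (2 * M ^ 2 * Real.exp (-s))) (G * (2 * M ^ 2 * (Real.exp (-s) * -1))) s :=
    (((hasDerivAt_neg s).exp).const_mul (2 * M ^ 2)).exp
  refine ⟨_, (dq.const_add 1).mul dG, ?_⟩
  have hG1 : 1 ≤ G := Real.one_le_exp (by positivity)
  have hq'b : q' ≤ - (gi (fun y => e y ^ 2) / I) + 2 * M ^ 2 * Real.exp (-s) * (1 + q) := by
    have : (- (gi (fun y => e y ^ 2) / I) + 2 * M ^ 2 * Real.exp (-s) * (1 + q)) * I =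
      - gi (fun y => e y ^ 2) + 2 * M ^ 2 * Real.exp (-s) * (D + I) := by
      rw [← hqI]; field_simp; ring
    rw [← this] at hmain
    exact le_of_mul_le_mul_right hmain hIpos
  have hee : 0 ≤ gi (fun y => e y ^ 2) / I := div_nonneg (gi_nonneg fun y => sq_nonneg _) hIpos.le
  show q' * G + (1 + q) * (G * (2 * M ^ 2 * (Real.exp (-s) * -1))) ≤ - (gi (fun y => e y ^ 2) / I)
  have h1 := mul_le_mul_of_nonneg_right hq'b (by linarith : 0 ≤ G)
  nlinarith

lemma OU.freq (h : OU w ws w1 w2 S0 C M) : ∃ Q : ℝ, 0 ≤ Q ∧ Tendsto (fq w w1) atTop (𝓝 Q) ∧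
    ∀ η > 0, ∃ J : ℝ, S0 < J ∧ ∀ j ≥ J, ∃ s ∈ Icc j (j + 1),
      gi (fun y => (w2 s y - y / 2 * w1 s y + fq w w1 s * w s y) ^ 2) ≤ η * gi (fun y => w s y ^ 2) := by
  set F : ℝ → ℝ := fun s => (1 + fq w w1 s) * Real.exp (2 * M ^ 2 * Real.exp (-s)) with hF
  choose! F' hF' hle using fun s (hs : S0 < s) => h.dF hs
  have hnn : ∀ s, S0 < s → 0 ≤ gi (fun y => (w2 s y - y / 2 * w1 s y + fq w w1 s * w s y) ^ 2) / gi (fun y => w s y ^ 2) :=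
    fun s hs => div_nonneg (gi_nonneg fun y => sq_nonneg _) (gi_nonneg fun y => sq_nonneg _)
  have hanti : AntitoneOn F (Ioi S0) := by
    apply antitoneOn_of_deriv_nonpos (convex_Ioi S0)
    · exact fun s hs => (hF' s hs).continuousAt.continuousWithinAt
    · rw [interior_Ioi]; exact fun s hs => (hF' s hs).differentiableAt.differentiableWithinAt
    · rw [interior_Ioi]; intro s hs
      rw [(hF' s hs).deriv]; linarith [hle s hs, hnn s hs]
  have hlim : ∃ L, Tendsto F atTop (𝓝 L) := by
    have h1 : Antitone (fun s => F (max s (S0 + 1))) := by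
      intro s t hst
      apply hanti
      · exact lt_of_lt_of_le (by linarith : S0 < S0 + 1) (le_max_right _ _)
      · exact lt_of_lt_of_le (by linarith : S0 < S0 + 1) (le_max_right _ _)
      · exact max_le_max_right _ hst
    have h2 := tendsto_atTop_ciInf h1 ⟨0, by
      rintro _ ⟨s, rfl⟩
      exact mul_nonneg (by linarith [fq_nonneg (w := w) (w1 := w1) (max s (S0 + 1))]) (Real.exp_pos _).le⟩
    refine ⟨_, h2.congr' ?_⟩
    filter_upwards [eventually_ge_atTop (S0 + 1)] with s hs
    rw [max_eq_left hs]
  obtain ⟨L, hL⟩ := hlim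
  have hq : Tendsto (fq w w1) atTop (𝓝 (L - 1)) := by
    have h1 : Tendsto (fun s : ℝ => Real.exp (-(2 * M ^ 2 * Real.exp (-s)))) atTop (𝓝 1) := by
      have h2 : Tendsto (fun s : ℝ => -(2 * M ^ 2 * Real.exp (-s))) atTop (𝓝 (-(2 * M ^ 2 * 0))) :=
        (Real.tendsto_exp_neg_atTop_nhds_zero.const_mul _).neg
      have h3 := (Real.continuous_exp.tendsto _).comp h2
      simpa [Function.comp_def] using h3
    have h4 := (hL.mul h1).sub_const 1
    rw [mul_one] at h4
    refine h4.congr fun s => ?_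
    simp only [hF]
    rw [mul_assoc, ← Real.exp_add]; simp
  refine ⟨L - 1, ge_of_tendsto' hq fun s => fq_nonneg s, hq, fun η hη => ?_⟩
  have hdiff : Tendsto (fun j => F j - F (j + 1)) atTop (𝓝 0) := by
    have := hL.sub (hL.comp (tendsto_atTop_add_const_right _ 1 tendsto_id))
    simpa using this
  have hev := (hdiff.eventually (gt_mem_nhds hη)).and (eventually_gt_atTop S0)
  obtain ⟨J, hJ⟩ := eventually_atTop.1 hev
  refine ⟨J, (hJ J le_rfl).2, fun j hj => ?_⟩
  obtain ⟨h1, h2⟩ := hJ j hj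
  obtain ⟨s, hs, hse⟩ := exists_hasDerivAt_eq_slope F F' (by linarith : j < j + 1)
    (fun s hs => (hF' s (lt_of_lt_of_le h2 hs.1)).continuousAt.continuousWithinAt)
    (fun s hs => hF' s (h2.trans hs.1))
  have hs0 : S0 < s := h2.trans hs.1
  refine ⟨s, ⟨hs.1.le, hs.2.le⟩, ?_⟩
  have h3 := hle s hs0
  rw [hse] at h3
  rw [← div_le_iff₀ (h.I_pos hs0)]
  have : (F (j + 1) - F j) / (j + 1 - j) = F (j + 1) - F j := by simp
  linarith

lemma OU.main (h : OU w ws w1 w2 S0 C M) : ∃ n : ℕ, ∀ ε > 0, ∃ J : ℝ, S0 < J ∧ ∀ j ≥ J, ∃ s ∈ Icc j (j + 1),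
    ∃ c : ℝ, c ≠ 0 ∧ ∀ y, |w s y - c * He n y| ≤ ε * |c| * Real.exp (y ^ 2 / 7) := by
  obtain ⟨Q, hQ, hlim, hE⟩ := h.freq
  set n := ⌊2 * Q + 1 / 2⌋₊ with hn
  have hn1 : (n : ℝ) ≤ 2 * Q + 1 / 2 := Nat.floor_le (by positivity)
  have hn2 : 2 * Q + 1 / 2 < n + 1 := Nat.lt_floor_add_one _
  set N := n + 6 with hN
  obtain ⟨Cst, hCst, happ⟩ := approx n N (by omega)
  refine ⟨n, fun ε hε => ?_⟩
  set nn := gi (fun y => He n y ^ 2) with hnn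
  have hnnpos : 0 < nn := He_norm_pos n
  obtain ⟨ρ, hρ, hρ1, hρ2⟩ : ∃ ρ > 0, Cst * ρ ^ 2 ≤ 1 / 2 ∧ Cst * ρ * Real.sqrt (2 * nn) ≤ ε := by
    have h1 : Tendsto (fun ρ : ℝ => Cst * ρ ^ 2) (𝓝[>] 0) (𝓝 0) := by
      have : Continuous (fun ρ : ℝ => Cst * ρ ^ 2) := by fun_prop
      simpa using (this.tendsto 0).mono_left nhdsWithin_le_nhds
    have h2 : Tendsto (fun ρ : ℝ => Cst * ρ * Real.sqrt (2 * nn)) (𝓝[>] 0) (𝓝 0) := by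
      have : Continuous (fun ρ : ℝ => Cst * ρ * Real.sqrt (2 * nn)) := by fun_prop
      simpa using (this.tendsto 0).mono_left nhdsWithin_le_nhds
    obtain ⟨ρ, h3, h4, h5⟩ := ((h1.eventually (gt_mem_nhds (by norm_num : (0:ℝ) < 1/2))).and
      ((h2.eventually (gt_mem_nhds hε)).and self_mem_nhdsWithin)).exists
    exact ⟨ρ, h5, h3.le, h4.le⟩
  obtain ⟨J1, hJ1, hJ1'⟩ := hE (ρ ^ 2) (by positivity)
  have hnear := hlim.eventually (Metric.ball_mem_nhds Q (by norm_num : (0:ℝ) < 1/8))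
  obtain ⟨J2, hJ2⟩ := eventually_atTop.1 hnear
  refine ⟨max J1 J2, lt_of_lt_of_le hJ1 (le_max_left _ _), fun j hj => ?_⟩
  obtain ⟨s, hs, hse⟩ := hJ1' j ((le_max_left _ _).trans hj)
  have hs0 : S0 < s := lt_of_lt_of_le hJ1 (((le_max_left _ _).trans hj).trans hs.1)
  have hqn := hJ2 s (((le_max_right _ _).trans hj).trans hs.1)
  rw [Real.dist_eq, abs_lt] at hqn
  set q := fq w w1 s with hq
  set I := gi (fun y => w s y ^ 2) with hI
  have hIpos : 0 < I := h.I_pos hs0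
  obtain ⟨c, hc1, hc2⟩ := happ q (fq_nonneg s) (by rw [hN]; push_cast; linarith) (by
      intro k hk
      rcases lt_or_gt_of_ne hk with hk | hk
      · have : (k : ℝ) + 1 ≤ n := by exact_mod_cast hk
        exact le_trans (by linarith) (le_abs_self _)
      · have : (n : ℝ) + 1 ≤ k := by exact_mod_cast hk
        exact le_trans (by linarith) (neg_le_abs _))
    (w s) (w1 s) (w2 s) (h.w_CE hs0) (h.w1_CE hs0) (h.w2_CE hs0) (fun y => h.d1 s y hs0)
    (fun y => h.d2 s y hs0) (ρ * Real.sqrt I) (by positivity)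
    (by rw [mul_pow, Real.sq_sqrt hIpos.le]; exact hse)
  rw [mul_pow, Real.sq_sqrt hIpos.le] at hc1
  have hIc : I ≤ c ^ 2 * (2 * nn) := by
    have : Cst * (ρ ^ 2 * I) ≤ 1 / 2 * I := by rw [← mul_assoc]; gcongr
    have hc1' : I ≤ c ^ 2 * nn + Cst * (ρ ^ 2 * I) := hc1
    linarith
  have hsq : Real.sqrt I ≤ |c| * Real.sqrt (2 * nn) := by
    calc _ ≤ Real.sqrt (c ^ 2 * (2 * nn)) := Real.sqrt_le_sqrt hIc
      _ = _ := by rw [Real.sqrt_mul (sq_nonneg c), Real.sqrt_sq_eq_abs]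
  refine ⟨s, hs, c, ?_, fun y => (hc2 y).trans ?_⟩
  · rintro rfl
    simp at hIc; linarith
  · gcongr ?_ * _
    calc Cst * (ρ * Real.sqrt I) ≤ Cst * (ρ * (|c| * Real.sqrt (2 * nn))) := by gcongr
      _ = (Cst * ρ * Real.sqrt (2 * nn)) * |c| := by ring
      _ ≤ _ := by gcongr

end
end ZN

namespace ZN
open MeasureTheory Filter Topology

lemma left_deriv_nonneg {g : ℝ → ℝ} {g' s0 s : ℝ} (hs : s0 < s) (hg : HasDerivAt g g' s)
    (hm : ∀ t ∈ Icc s0 s, g t ≤ g s) : 0 ≤ g' := by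
  have h1 := (hasDerivWithinAt_iff_tendsto_slope' (by simp : s ∉ Iio s)).1 (hg.hasDerivWithinAt (s := Iio s))
  refine ge_of_tendsto h1 ?_
  filter_upwards [Ioo_mem_nhdsLT hs] with t ht
  rw [slope_def_field]
  exact div_nonneg_of_nonpos (by linarith [hm t ⟨ht.1.le, ht.2.le⟩]) (by linarith [ht.2])

lemma second_deriv_nonpos {f f' : ℝ → ℝ} {f'' l r x : ℝ} (hx : x ∈ Ioo l r)
    (hf : ∀ y ∈ Ioo l r, HasDerivAt f (f' y) y) (hf' : HasDerivAt f' f'' x)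
    (hm : ∀ y ∈ Ioo l r, f y ≤ f x) : f' x = 0 ∧ f'' ≤ 0 := by
  have h0 : f' x = 0 := by
    have : IsLocalMax f x := by
      filter_upwards [Ioo_mem_nhds hx.1 hx.2] with y hy using hm y hy
    exact this.hasDerivAt_eq_zero (hf x hx)
  refine ⟨h0, ?_⟩
  by_contra hpos
  push Not at hpos
  have h1 := (hasDerivAt_iff_tendsto_slope.1 hf').eventually (lt_mem_nhds hpos)
  have h2 : ∀ᶠ y in 𝓝[>] x, 0 < slope f' x y := h1.filter_mono (nhdsWithin_mono _ (fun y hy => ne_of_gt hy))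
  obtain ⟨u, hu, hsub⟩ := (mem_nhdsGT_iff_exists_Ioo_subset).1 (h2.and (Ioo_mem_nhdsGT hx.2))
  have hu' : x < u := hu
  set y := (x + u) / 2 with hy
  have hyI : y ∈ Ioo x u := ⟨by rw [hy]; linarith, by rw [hy]; linarith⟩
  have hyr : y < r := (hsub hyI).2.2
  obtain ⟨ξ, hξ, hξe⟩ := exists_hasDerivAt_eq_slope f f' hyI.1
    (fun z hz => (hf z ⟨lt_of_lt_of_le hx.1 hz.1, lt_of_le_of_lt hz.2 hyr⟩).continuousAt.continuousWithinAt)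
    (fun z hz => hf z ⟨hx.1.trans hz.1, hz.2.trans hyr⟩)
  have h3 := (hsub ⟨hξ.1, hξ.2.trans hyI.2⟩ : _ ∧ _).1
  rw [slope_def_field, h0, sub_zero] at h3
  have h4 : 0 < f' ξ := by
    have := (div_pos_iff_of_pos_right (by linarith [hξ.1] : 0 < ξ - x)).1 h3
    exact this
  rw [hξe] at h4
  have h5 := (div_pos_iff_of_pos_right (by linarith [hyI.1] : 0 < y - x)).1 h4
  linarith [hm y ⟨hx.1.trans hyI.1, hyr⟩]

/-- weak maximum principle -/
lemma maxprinc {Z Zs Zx Zxx : ℝ → ℝ → ℝ} {s0 s1 l r A : ℝ}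
    (hc : ContinuousOn (fun p : ℝ × ℝ => Z p.1 p.2) (Icc s0 s1 ×ˢ Icc l r))
    (ds : ∀ s ∈ Ioc s0 s1, ∀ x ∈ Ioo l r, HasDerivAt (fun s => Z s x) (Zs s x) s)
    (dx : ∀ s ∈ Ioc s0 s1, ∀ x ∈ Ioo l r, HasDerivAt (fun y => Z s y) (Zx s x) x)
    (dxx : ∀ s ∈ Ioc s0 s1, ∀ x ∈ Ioo l r, HasDerivAt (fun y => Zx s y) (Zxx s x) x)
    (b0 : ∀ x ∈ Icc l r, Z s0 x ≤ 0) (bl : ∀ s ∈ Icc s0 s1, Z s l ≤ 0) (br : ∀ s ∈ Icc s0 s1, Z s r ≤ 0)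
    (hA : ∀ s ∈ Ioc s0 s1, ∀ x ∈ Ioo l r, 0 < Z s x → Zx s x = 0 → Zxx s x ≤ 0 → Zs s x ≤ A * Z s x) :
    ∀ s ∈ Icc s0 s1, ∀ x ∈ Icc l r, Z s x ≤ 0 := by
  intro s hs x hx
  by_contra hpos
  push Not at hpos
  obtain ⟨⟨t, y⟩, ⟨ht, hy⟩, hmax⟩ := (isCompact_Icc.prod isCompact_Icc).exists_isMaxOn
    (f := fun p : ℝ × ℝ => Real.exp (-(A + 1) * p.1) * Z p.1 p.2) ⟨(s, x), hs, hx⟩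
    (ContinuousOn.mul (by fun_prop) hc)
  have hm : ∀ t' ∈ Icc s0 s1, ∀ y' ∈ Icc l r,
      Real.exp (-(A + 1) * t') * Z t' y' ≤ Real.exp (-(A + 1) * t) * Z t y :=
    fun t' ht' y' hy' => hmax (show (t', y') ∈ Icc s0 s1 ×ˢ Icc l r from ⟨ht', hy'⟩)
  simp only at ht hy
  have hZ : 0 < Z t y := by
    have h1 := hm s hs x hx
    have h2 : 0 < Real.exp (-(A + 1) * t) * Z t y := lt_of_lt_of_le (mul_pos (Real.exp_pos _) hpos) h1
    exact (mul_pos_iff_of_pos_left (Real.exp_pos _)).1 h2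
  have ht' : t ∈ Ioc s0 s1 := by
    refine ⟨lt_of_le_of_ne ht.1 ?_, ht.2⟩
    rintro rfl; linarith [b0 y hy]
  have hy' : y ∈ Ioo l r := by
    refine ⟨lt_of_le_of_ne hy.1 ?_, lt_of_le_of_ne hy.2 ?_⟩
    · rintro rfl; linarith [bl t ht]
    · rintro rfl; linarith [br t ht]
  obtain ⟨h1, h2⟩ := second_deriv_nonpos (f := fun y => Z t y) (f' := fun y => Zx t y) hy' (fun z hz => dx t ht' z hz) (dxx t ht' y hy')
    (fun z hz => le_of_mul_le_mul_left (hm t ht z ⟨hz.1.le, hz.2.le⟩) (Real.exp_pos _))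
  have h3 := hA t ht' y hy' hZ h1 h2
  have h4 : HasDerivAt (fun t => Real.exp (-(A + 1) * t)) (Real.exp (-(A + 1) * t) * (-(A + 1) * 1)) t :=
    ((hasDerivAt_id t).const_mul (-(A + 1))).exp
  have h5 := left_deriv_nonneg ht'.1 (h4.mul (ds t ht' y hy')) (fun t' h => hm t' ⟨h.1, h.2.trans ht.2⟩ y hy)
  have h6 : Real.exp (-(A + 1) * t) * (-(A + 1) * 1) * Z t y + Real.exp (-(A + 1) * t) * Zs t y =
    Real.exp (-(A + 1) * t) * (Zs t y - (A + 1) * Z t y) := by ring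
  have h7 : 0 ≤ Zs t y - (A + 1) * Z t y := by
    have : 0 ≤ Real.exp (-(A + 1) * t) * (Zs t y - (A + 1) * Z t y) := h6 ▸ h5
    exact (mul_nonneg_iff_of_pos_left (Real.exp_pos _)).1 this
  linarith

end ZN

namespace ZN
open MeasureTheory Filter Topology

lemma HP_cont (n : ℕ) : Continuous (fun p : ℝ × ℝ => HP n p.1 p.2) := by
  induction n using Nat.strong_induction_on with
  | _ n ih =>
    match n, ih with
    | 0, _ => simpa [HP] using continuous_const
    | 1, _ => simpa [HP] using continuous_snd
    | (n + 2), ih =>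
      have h1 := ih (n + 1) (by omega)
      have h0 := ih n (by omega)
      simp only [HP]
      fun_prop

set_option maxHeartbeats 1000000 in
lemma barrier_one (n : ℕ) (M : ℝ) (hM : 0 ≤ M) : ∃ Λ : ℝ, ∀ (V Vs Vx Vxx α β : ℝ → ℝ → ℝ) (μ c ε Cb : ℝ),
    0 < μ → μ ≤ 1 → 0 ≤ ε → c ≠ 0 →
    ContinuousOn (fun p : ℝ × ℝ => V p.1 p.2) (Icc 0 1 ×ˢ univ) →
    (∀ s ∈ Icc (0:ℝ) 1, ∀ y, HasDerivAt (fun s => V s y) (Vs s y) s) →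
    (∀ s ∈ Icc (0:ℝ) 1, ∀ y, HasDerivAt (fun y => V s y) (Vx s y) y) →
    (∀ s ∈ Icc (0:ℝ) 1, ∀ y, HasDerivAt (fun y => Vx s y) (Vxx s y) y) →
    (∀ s ∈ Icc (0:ℝ) 1, ∀ y, Vs s y = Vxx s y + μ * α s y * Vx s y + μ ^ 2 * β s y * V s y) →
    (∀ s ∈ Icc (0:ℝ) 1, ∀ y, |α s y| ≤ M) → (∀ s ∈ Icc (0:ℝ) 1, ∀ y, |β s y| ≤ M) →
    (∀ s ∈ Icc (0:ℝ) 1, ∀ y, |V s y| ≤ Cb) →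
    (∀ y, V 0 y - c * He n y ≤ ε * |c| * Real.exp (y ^ 2 / 7)) →
    ∀ y, V 1 y - c * y ^ n ≤ |c| * (ε + μ) * Real.exp (Λ + y ^ 2 / 2) := by
  obtain ⟨C1, hC1, hb1⟩ := HP_bound_gauss n
  obtain ⟨C2, hC2, hb2⟩ := HP_bound_gauss (n - 1)
  obtain ⟨C3, hC3, hb3⟩ := HP_bound n
  set Cn := C1 + n * C2 with hCn
  have hCn0 : 0 ≤ Cn := by positivity
  set Λ := 1 + M ^ 2 + M + M * Cn with hΛ
  have hΛ0 : 0 ≤ Λ := by positivity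
  refine ⟨Λ, ?_⟩
  intro V Vs Vx Vxx α β μ c ε Cb hμ hμ1 hε hc hVc dVs dVx dVxx heq hα hβ hV hinit y
  have hc' : 0 < |c| := abs_pos.2 hc
  set κ := |c| * (ε + μ) with hκ
  have hκ0 : 0 < κ := by positivity
  have hCb : 0 ≤ Cb := (abs_nonneg _).trans (hV 0 (by simp) 0)
  set R := max (max (|y| + 1) (7 * (n + 1))) ((Cb + |c| * C3) / κ) with hR
  have hR1 : |y| + 1 ≤ R := (le_max_left _ _).trans (le_max_left _ _)
  have hR2 : 7 * ((n:ℝ) + 1) ≤ R := (le_max_right _ _).trans (le_max_left _ _)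
  have hR3 : (Cb + |c| * C3) / κ ≤ R := le_max_right _ _
  have hR0 : 0 ≤ R := by linarith [abs_nonneg y]
  set ξ : ℝ → ℝ := fun τ => (7 - 5 * τ)⁻¹ with hξ
  have hξpos : ∀ τ ∈ Icc (0:ℝ) 1, 1 / 7 ≤ ξ τ ∧ ξ τ ≤ 1 / 2 := by
    intro τ hτ
    simp only [hξ]
    constructor
    · rw [one_div]; apply inv_anti₀ <;> linarith [hτ.1, hτ.2]
    · rw [one_div]; apply inv_anti₀ <;> linarith [hτ.1, hτ.2]
  set B : ℝ → ℝ → ℝ := fun τ y => Real.exp (ξ τ * y ^ 2 + Λ * τ) with hB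
  have hBpos : ∀ τ y, 0 < B τ y := fun τ y => Real.exp_pos _
  have hBge : ∀ τ ∈ Icc (0:ℝ) 1, ∀ y, Real.exp (y ^ 2 / 7) ≤ B τ y := by
    intro τ hτ y
    apply Real.exp_le_exp.2
    have := (hξpos τ hτ).1
    have h2 := mul_le_mul_of_nonneg_right this (sq_nonneg y)
    have h3 := mul_nonneg hΛ0 hτ.1
    linarith
  have dBs : ∀ τ ∈ Icc (0:ℝ) 1, ∀ y, HasDerivAt (fun τ => B τ y) (B τ y * (5 * ξ τ ^ 2 * y ^ 2 + Λ)) τ := by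
    intro τ hτ y
    have hne : 7 - 5 * τ ≠ 0 := by linarith [hτ.2]
    have h1 : HasDerivAt (fun τ : ℝ => 7 - 5 * τ) (-(5 * 1)) τ := ((hasDerivAt_id τ).const_mul 5).const_sub 7
    have h2 := ((h1.inv hne).mul_const (y ^ 2)).add ((hasDerivAt_id τ).const_mul Λ)
    exact hd h2.exp (fun z => rfl) (by simp only [hB, hξ]; simp; left; field_simp)
  have dBx : ∀ τ y, HasDerivAt (fun y => B τ y) (B τ y * (2 * ξ τ * y)) y := by
    intro τ y
    have h1 : HasDerivAt (fun y : ℝ => ξ τ * y ^ 2 + Λ * τ) (2 * ξ τ * y) y :=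
      hd (((hasDerivAt_pow 2 y).const_mul (ξ τ)).add_const (Λ * τ)) (fun z => rfl) (by simp; ring)
    exact hd h1.exp (fun z => rfl) rfl
  have dBxx : ∀ τ y, HasDerivAt (fun y => B τ y * (2 * ξ τ * y)) (B τ y * (2 * ξ τ + 4 * ξ τ ^ 2 * y ^ 2)) y := by
    intro τ y
    have h1 : HasDerivAt (fun y : ℝ => 2 * ξ τ * y) (2 * ξ τ * 1) y := (hasDerivAt_id y).const_mul _
    exact hd ((dBx τ y).mul h1) (fun z => rfl) (by ring)
  have hBc : ContinuousOn (fun p : ℝ × ℝ => B p.1 p.2) (Icc 0 1 ×ˢ univ) := by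
    have : ContinuousOn (fun p : ℝ × ℝ => ξ p.1) (Icc 0 1 ×ˢ univ) := by
      apply ContinuousOn.inv₀ (by fun_prop)
      rintro ⟨τ, z⟩ ⟨hτ, -⟩
      have : τ ≤ 1 := hτ.2
      simp only; linarith
    have h2 : ContinuousOn (fun p : ℝ × ℝ => p.2 ^ 2) (Icc 0 1 ×ˢ univ) := by fun_prop
    have h3 : ContinuousOn (fun p : ℝ × ℝ => Λ * p.1) (Icc 0 1 ×ˢ univ) := by fun_prop
    exact ((this.mul h2).add h3).rexp
  have hmp := maxprinc (Z := fun τ y => V τ y - c * HP n (τ - 1) y - κ * B τ y)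
    (Zs := fun τ y => Vs τ y - c * (n * (((n - 1 : ℕ) : ℝ) * HP (n - 2) (τ - 1) y)) -
      κ * (B τ y * (5 * ξ τ ^ 2 * y ^ 2 + Λ)))
    (Zx := fun τ y => Vx τ y - c * (n * HP (n - 1) (τ - 1) y) - κ * (B τ y * (2 * ξ τ * y)))
    (Zxx := fun τ y => Vxx τ y - c * (n * (((n - 1 : ℕ) : ℝ) * HP (n - 2) (τ - 1) y)) -
      κ * (B τ y * (2 * ξ τ + 4 * ξ τ ^ 2 * y ^ 2)))
    (s0 := 0) (s1 := 1) (l := -R) (r := R) (A := M) ?_ ?_ ?_ ?_ ?_ ?_ ?_ ?_ 1 (by simp) y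
    ⟨by linarith [neg_abs_le y], by linarith [le_abs_self y]⟩
  · have hB1 : B 1 y = Real.exp (Λ + y ^ 2 / 2) := by simp only [hB, hξ]; norm_num; ring
    rw [hB1] at hmp
    simp only [sub_self, HP_at_zero] at hmp
    linarith
  · have h1 : Continuous (fun p : ℝ × ℝ => HP n (p.1 - 1) p.2) :=
      (HP_cont n).comp (by fun_prop : Continuous (fun p : ℝ × ℝ => (p.1 - 1, p.2)))
    exact (((hVc.sub (h1.continuousOn.const_mul c)).sub (hBc.const_mul κ))).mono
      (prod_mono le_rfl (subset_univ _))
  · intro s hs x _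
    have hs' : s ∈ Icc (0:ℝ) 1 := ⟨hs.1.le, hs.2⟩
    have h1 : HasDerivAt (fun s : ℝ => HP n (s - 1) x) (n * (((n - 1 : ℕ) : ℝ) * HP (n - 2) (s - 1) x)) s :=
      (HP_dθ n (s - 1) x).comp_sub_const s 1
    exact ((dVs s hs' x).sub (h1.const_mul c)).sub ((dBs s hs' x).const_mul κ)
  · intro s hs x _
    have hs' : s ∈ Icc (0:ℝ) 1 := ⟨hs.1.le, hs.2⟩
    exact ((dVx s hs' x).sub ((HP_dy n (s - 1) x).const_mul c)).sub ((dBx s x).const_mul κ)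
  · intro s hs x _
    have hs' : s ∈ Icc (0:ℝ) 1 := ⟨hs.1.le, hs.2⟩
    have h1 := ((HP_dy (n - 1) (s - 1) x).const_mul (n:ℝ)).const_mul c
    have h2 : n - 1 - 1 = n - 2 := by omega
    rw [h2] at h1
    exact ((dVxx s hs' x).sub h1).sub ((dBxx s x).const_mul κ)
  · intro x _
    have h1 := hinit x
    have h2 := hBge 0 (by simp) x
    have h3 : ε * |c| ≤ κ := by rw [hκ]; nlinarith
    have h4 : ε * |c| * Real.exp (x ^ 2 / 7) ≤ κ * B 0 x := mul_le_mul h3 h2 (Real.exp_pos _).le hκ0.le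
    simp only [zero_sub]
    have : He n x = HP n (-1) x := rfl
    rw [← this]; linarith
  all_goals try
    intro s hs
    have hs1 : |s - 1| ≤ 1 := by rw [abs_le]; constructor <;> linarith [hs.1, hs.2]
    have key : ∀ x : ℝ, |x| = R → V s x - c * HP n (s - 1) x - κ * B s x ≤ 0 := by
      intro x hx
      have h1 := hb3 (s - 1) x hs1
      have h2 := hV s hs x
      have h3 := hBge s hs x
      rw [hx] at h1
      have h4 : |c * HP n (s - 1) x| ≤ |c| * (C3 * Real.exp (n * R)) := by
        rw [abs_mul]; gcongr
      have h5 : V s x - c * HP n (s - 1) x ≤ Cb + |c| * (C3 * Real.exp (n * R)) := by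
        linarith [le_abs_self (V s x), neg_abs_le (c * HP n (s - 1) x)]
      have h6 : 1 ≤ Real.exp (n * R) := Real.one_le_exp (by positivity)
      have h7 : Cb + |c| * (C3 * Real.exp (n * R)) ≤ (Cb + |c| * C3) * Real.exp (n * R) := by nlinarith
      have h8 : (Cb + |c| * C3) ≤ κ * R := by rwa [div_le_iff₀' hκ0] at hR3
      have h9 : R * Real.exp (n * R) ≤ Real.exp (x ^ 2 / 7) := by
        have e1 : R ≤ Real.exp R := by linarith [Real.add_one_le_exp R]
        calc R * Real.exp (n * R) ≤ Real.exp R * Real.exp (n * R) := by gcongr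
          _ = Real.exp (R + n * R) := by rw [Real.exp_add]
          _ ≤ _ := by apply Real.exp_le_exp.2; rw [← sq_abs, hx]; nlinarith
      have h10 : (Cb + |c| * C3) * Real.exp (n * R) ≤ κ * B s x := by
        calc _ ≤ κ * R * Real.exp (n * R) := by gcongr
          _ = κ * (R * Real.exp (n * R)) := by ring
          _ ≤ κ * B s x := by gcongr; exact h9.trans h3
      linarith
    first
      | exact key (-R) (by rw [abs_neg, abs_of_nonneg hR0])
      | exact key R (abs_of_nonneg hR0)
  intro s hs x _ hZ hZx hZxx
  have hs' : s ∈ Icc (0:ℝ) 1 := ⟨hs.1.le, hs.2⟩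
  have hs1 : |s - 1| ≤ 1 := by rw [abs_le]; constructor <;> linarith [hs.1, hs.2]
  set H := HP n (s - 1) x with hH
  set H1 := (n:ℝ) * HP (n - 1) (s - 1) x with hH1
  set H2 := (n:ℝ) * (((n - 1 : ℕ) : ℝ) * HP (n - 2) (s - 1) x) with hH2
  set b := B s x with hb
  have hb0 : 0 < b := hBpos s x
  set z := V s x - c * H - κ * b with hz
  have eV : V s x = z + c * H + κ * b := by rw [hz]; ring
  have eVx : Vx s x = c * H1 + κ * (b * (2 * ξ s * x)) := by linarith
  have hα' := hα s hs' x
  have hβ' := hβ s hs' x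
  have hg1 : |H| ≤ C1 * b := (hb1 _ x hs1).trans (by gcongr; exact hBge s hs' x)
  have hg2 : |H1| ≤ n * C2 * b := by
    rw [hH1, abs_mul, Nat.abs_cast, mul_assoc]
    gcongr
    exact (hb2 _ x hs1).trans (by gcongr; exact hBge s hs' x)
  have hμ2 : μ ^ 2 ≤ μ := by nlinarith
  have hcκ : μ * |c| ≤ κ := by rw [hκ]; nlinarith
  have t1 : μ * α s x * (c * H1) ≤ M * (n * C2) * (κ * b) := by
    calc μ * α s x * (c * H1) ≤ |μ * α s x * (c * H1)| := le_abs_self _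
      _ = (μ * |c|) * |α s x| * |H1| := by rw [abs_mul, abs_mul, abs_mul, abs_of_pos hμ]; ring
      _ ≤ κ * M * (n * C2 * b) := by gcongr
      _ = _ := by ring
  have t2 : μ ^ 2 * β s x * (c * H) ≤ M * C1 * (κ * b) := by
    calc μ ^ 2 * β s x * (c * H) ≤ |μ ^ 2 * β s x * (c * H)| := le_abs_self _
      _ = (μ ^ 2 * |c|) * |β s x| * |H| := by rw [abs_mul, abs_mul, abs_mul, abs_of_pos (by positivity : 0 < μ ^ 2)]; ring
      _ ≤ κ * M * (C1 * b) := by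
        have : μ ^ 2 * |c| ≤ κ := le_trans (by gcongr) hcκ
        gcongr
      _ = _ := by ring
  have t3 : μ ^ 2 * β s x * z ≤ M * z := by
    apply mul_le_mul_of_nonneg_right _ hZ.le
    calc μ ^ 2 * β s x ≤ |μ ^ 2 * β s x| := le_abs_self _
      _ = μ ^ 2 * |β s x| := by rw [abs_mul, abs_of_pos (by positivity : 0 < μ ^ 2)]
      _ ≤ 1 * M := by
        have : μ ^ 2 ≤ 1 := by linarith
        gcongr
      _ = M := one_mul M
  have t4 : μ ^ 2 * β s x * (κ * b) ≤ M * (κ * b) := by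
    apply mul_le_mul_of_nonneg_right _ (by positivity)
    calc μ ^ 2 * β s x ≤ |μ ^ 2 * β s x| := le_abs_self _
      _ = μ ^ 2 * |β s x| := by rw [abs_mul, abs_of_pos (by positivity : 0 < μ ^ 2)]
      _ ≤ 1 * M := by
        have : μ ^ 2 ≤ 1 := by linarith
        gcongr
      _ = M := one_mul M
  have hξs := hξpos s hs'
  have t5 : μ * α s x * (κ * (b * (2 * ξ s * x))) ≤ (M ^ 2 + ξ s ^ 2 * x ^ 2) * (κ * b) := by
    have : μ * α s x * (2 * ξ s * x) ≤ M ^ 2 + ξ s ^ 2 * x ^ 2 := by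
      have e1 : (μ * α s x) ^ 2 ≤ M ^ 2 := by
        rw [← sq_abs, abs_mul, abs_of_pos hμ]
        apply pow_le_pow_left₀ (by positivity)
        calc μ * |α s x| ≤ 1 * M := by gcongr
          _ = M := one_mul M
      nlinarith [sq_nonneg (μ * α s x - ξ s * x)]
    calc _ = μ * α s x * (2 * ξ s * x) * (κ * b) := by ring
      _ ≤ _ := mul_le_mul_of_nonneg_right this (by positivity)
  have t6 : 2 * ξ s * (κ * b) ≤ 1 * (κ * b) := mul_le_mul_of_nonneg_right (by linarith) (by positivity)
  have eq1 : Vs s x - c * H2 - κ * (b * (5 * ξ s ^ 2 * x ^ 2 + Λ)) =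
    (Vxx s x - c * H2 - κ * (b * (2 * ξ s + 4 * ξ s ^ 2 * x ^ 2)))
    + μ * α s x * (c * H1) + μ ^ 2 * β s x * (c * H) + μ ^ 2 * β s x * z + μ ^ 2 * β s x * (κ * b)
    + μ * α s x * (κ * (b * (2 * ξ s * x))) + 2 * ξ s * (κ * b) - (ξ s ^ 2 * x ^ 2 + Λ) * (κ * b) := by
    rw [heq s hs' x, eVx, eV]; ring
  rw [eq1, hΛ, hCn]
  linarith

lemma barrier (n : ℕ) (M : ℝ) (hM : 0 ≤ M) : ∃ Λ : ℝ, ∀ (V Vs Vx Vxx α β : ℝ → ℝ → ℝ) (μ c ε Cb : ℝ),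
    0 < μ → μ ≤ 1 → 0 ≤ ε → c ≠ 0 →
    ContinuousOn (fun p : ℝ × ℝ => V p.1 p.2) (Icc 0 1 ×ˢ univ) →
    (∀ s ∈ Icc (0:ℝ) 1, ∀ y, HasDerivAt (fun s => V s y) (Vs s y) s) →
    (∀ s ∈ Icc (0:ℝ) 1, ∀ y, HasDerivAt (fun y => V s y) (Vx s y) y) →
    (∀ s ∈ Icc (0:ℝ) 1, ∀ y, HasDerivAt (fun y => Vx s y) (Vxx s y) y) →
    (∀ s ∈ Icc (0:ℝ) 1, ∀ y, Vs s y = Vxx s y + μ * α s y * Vx s y + μ ^ 2 * β s y * V s y) →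
    (∀ s ∈ Icc (0:ℝ) 1, ∀ y, |α s y| ≤ M) → (∀ s ∈ Icc (0:ℝ) 1, ∀ y, |β s y| ≤ M) →
    (∀ s ∈ Icc (0:ℝ) 1, ∀ y, |V s y| ≤ Cb) →
    (∀ y, |V 0 y - c * He n y| ≤ ε * |c| * Real.exp (y ^ 2 / 7)) →
    ∀ y, |V 1 y - c * y ^ n| ≤ |c| * (ε + μ) * Real.exp (Λ + y ^ 2 / 2) := by
  obtain ⟨Λ, hΛ⟩ := barrier_one n M hM
  refine ⟨Λ, ?_⟩
  intro V Vs Vx Vxx α β μ c ε Cb hμ hμ1 hε hc hVc dVs dVx dVxx heq hα hβ hV hinit y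
  have h1 := hΛ V Vs Vx Vxx α β μ c ε Cb hμ hμ1 hε hc hVc dVs dVx dVxx heq hα hβ hV
    (fun y => (le_abs_self _).trans (hinit y)) y
  have h2 := hΛ (fun s y => - V s y) (fun s y => - Vs s y) (fun s y => - Vx s y) (fun s y => - Vxx s y)
    α β μ (-c) ε Cb hμ hμ1 hε (neg_ne_zero.2 hc) hVc.neg (fun s hs y => (dVs s hs y).neg)
    (fun s hs y => (dVx s hs y).neg) (fun s hs y => (dVxx s hs y).neg)
    (fun s hs y => by simp only [heq s hs y]; ring) hα hβ (fun s hs y => by rw [abs_neg]; exact hV s hs y)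
    (fun y => by rw [abs_neg]; linarith [neg_abs_le (V 0 y - c * He n y), hinit y]) y
  rw [abs_neg] at h2
  rw [abs_le]; constructor <;> linarith

end ZN

namespace ZN
open MeasureTheory Filter Topology

/-- classical solutions on positive times -/
structure Sol (a b v vt vx vxx : ℝ → ℝ → ℝ) (M : ℝ) : Prop where
  hM : 0 ≤ M
  aB : ∀ t x, 0 < t → |a t x| ≤ M
  bB : ∀ t x, 0 < t → |b t x| ≤ M
  P : ∀ t x, 0 < t → v t (x + 2 * π) = v t x
  dt : ∀ t x, 0 < t → HasDerivAt (fun s => v s x) (vt t x) t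
  dx : ∀ t x, 0 < t → HasDerivAt (fun y => v t y) (vx t x) x
  dxx : ∀ t x, 0 < t → HasDerivAt (fun y => vx t y) (vxx t x) x
  vC : ContinuousOn (fun p : ℝ × ℝ => v p.1 p.2) (Ioi 0 ×ˢ univ)
  vtC : ContinuousOn (fun p : ℝ × ℝ => vt p.1 p.2) (Ioi 0 ×ˢ univ)
  vxC : ContinuousOn (fun p : ℝ × ℝ => vx p.1 p.2) (Ioi 0 ×ˢ univ)
  vxxC : ContinuousOn (fun p : ℝ × ℝ => vxx p.1 p.2) (Ioi 0 ×ˢ univ)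
  eq : ∀ t x, 0 < t → vt t x = vxx t x + a t x * vx t x + b t x * v t x
  nz : ∀ t, 0 < t → ∃ x, v t x ≠ 0

lemma ca_of {f : ℝ → ℝ → ℝ} (hf : ContinuousOn (fun p : ℝ × ℝ => f p.1 p.2) (Ioi 0 ×ˢ univ))
    {t : ℝ} (ht : 0 < t) (x : ℝ) : ContinuousAt (fun p : ℝ × ℝ => f p.1 p.2) (t, x) :=
  hf.continuousAt ((isOpen_Ioi.prod isOpen_univ).mem_nhds ⟨ht, mem_univ _⟩)

lemma ca_comp {X : Type*} [TopologicalSpace X] {f : ℝ → ℝ → ℝ}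
    (hf : ContinuousOn (fun p : ℝ × ℝ => f p.1 p.2) (Ioi 0 ×ˢ univ))
    {γ χ : X → ℝ} {s : X} (hs : 0 < γ s) (hγ : ContinuousAt γ s) (hχ : ContinuousAt χ s) :
    ContinuousAt (fun s => f (γ s) (χ s)) s :=
  ContinuousAt.comp (g := fun p : ℝ × ℝ => f p.1 p.2) (f := fun s => (γ s, χ s)) (ca_of hf hs _)
    (hγ.prodMk hχ)

lemma per_bdd {f : ℝ → ℝ → ℝ} (hf : ContinuousOn (fun p : ℝ × ℝ => f p.1 p.2) (Ioi 0 ×ˢ univ))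
    (hP : ∀ t x, 0 < t → f t (x + 2 * π) = f t x) {t1 t2 : ℝ} (h1 : 0 < t1) :
    ∃ C, 0 ≤ C ∧ ∀ t ∈ Icc t1 t2, ∀ x, |f t x| ≤ C := by
  obtain ⟨C, hC⟩ := (isCompact_Icc.prod isCompact_Icc : IsCompact (Icc t1 t2 ×ˢ Icc 0 (2 * π))).exists_bound_of_continuousOn
    (hf.mono (prod_mono (fun t ht => lt_of_lt_of_le h1 ht.1) (subset_univ _)))
  refine ⟨max C 0, le_max_right _ _, fun t ht x => ?_⟩
  obtain ⟨y, hy, he⟩ := Function.Periodic.exists_mem_Ico₀ (f := f t)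
    (fun x => hP t x (lt_of_lt_of_le h1 ht.1)) Real.two_pi_pos x
  rw [he]
  exact (hC (t, y) ⟨ht, hy.1, hy.2.le⟩).trans (le_max_left _ _)

section
variable {a b v vt vx vxx : ℝ → ℝ → ℝ} {M : ℝ}

lemma Sol.vxP (h : Sol a b v vt vx vxx M) : ∀ t x, 0 < t → vx t (x + 2 * π) = vx t x := by
  intro t x ht
  have h1 := (h.dx t (x + 2 * π) ht).comp_add_const x (2 * π)
  have h2 : (fun y => v t (y + 2 * π)) = fun y => v t y := funext fun y => h.P t y ht
  rw [h2] at h1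
  exact h1.unique (h.dx t x ht)

lemma Sol.vxxP (h : Sol a b v vt vx vxx M) : ∀ t x, 0 < t → vxx t (x + 2 * π) = vxx t x := by
  intro t x ht
  have h1 := (h.dxx t (x + 2 * π) ht).comp_add_const x (2 * π)
  have h2 : (fun y => vx t (y + 2 * π)) = fun y => vx t y := funext fun y => h.vxP t y ht
  rw [h2] at h1
  exact h1.unique (h.dxx t x ht)

lemma Sol.vtP (h : Sol a b v vt vx vxx M) : ∀ t x, 0 < t → vt t (x + 2 * π) = vt t x := by
  intro t x ht
  have h1 := h.dt t (x + 2 * π) ht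
  have h2 : HasDerivAt (fun s => v s x) (vt t (x + 2 * π)) t := by
    refine h1.congr_of_eventuallyEq ?_
    filter_upwards [Ioi_mem_nhds ht] with s hs
    exact (h.P s x hs).symm
  exact h2.unique (h.dt t x ht)

lemma Sol.bdd (h : Sol a b v vt vx vxx M) {t1 t2 : ℝ} (h1 : 0 < t1) : ∃ C, 0 ≤ C ∧ ∀ t ∈ Icc t1 t2, ∀ x,
    |v t x| ≤ C ∧ |vt t x| ≤ C ∧ |vx t x| ≤ C ∧ |vxx t x| ≤ C := by
  obtain ⟨C1, p1, q1⟩ := per_bdd h.vC h.P (t2 := t2) h1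
  obtain ⟨C2, p2, q2⟩ := per_bdd h.vtC h.vtP (t2 := t2) h1
  obtain ⟨C3, p3, q3⟩ := per_bdd h.vxC h.vxP (t2 := t2) h1
  obtain ⟨C4, p4, q4⟩ := per_bdd h.vxxC h.vxxP (t2 := t2) h1
  refine ⟨C1 + C2 + C3 + C4, by positivity, fun t ht x => ?_⟩
  have := q1 t ht x
  have := q2 t ht x
  have := q3 t ht x
  have := q4 t ht x
  refine ⟨?_, ?_, ?_, ?_⟩ <;> linarith

lemma Sol.chain (h : Sol a b v vt vx vxx M) {γ χ : ℝ → ℝ} {γ' χ' s : ℝ} (hs : 0 < γ s)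
    (hγ : HasDerivAt γ γ' s) (hχ : HasDerivAt χ χ' s) :
    HasDerivAt (fun s => v (γ s) (χ s)) (γ' * vt (γ s) (χ s) + χ' * vx (γ s) (χ s)) s := by
  have hmem : (Ioi (0:ℝ) ×ˢ (univ : Set ℝ)) ∈ 𝓝 (γ s, χ s) :=
    (isOpen_Ioi.prod isOpen_univ).mem_nhds ⟨hs, mem_univ _⟩
  have hF := hasStrictFDerivAt_uncurry_coprod (𝕜 := ℝ) (u := (γ s, χ s)) (f := v)
    (f₁ := fun t x => ContinuousLinearMap.toSpanSingleton ℝ (vt t x))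
    (f₂ := fun t x => ContinuousLinearMap.toSpanSingleton ℝ (vx t x)) ?_ ?_ ?_ ?_
  · have := hF.hasFDerivAt.comp_hasDerivAt s (hγ.prodMk hχ)
    refine hd this (fun z => rfl) ?_
    simp [Function.HasUncurry.uncurry]
  · filter_upwards [hmem] with p hp
    exact (h.dt p.1 p.2 hp.1).hasFDerivAt
  · filter_upwards [hmem] with p hp
    exact (h.dx p.1 p.2 hp.1).hasFDerivAt
  · exact (ContinuousLinearMap.toSpanSingletonCLE (𝕜 := ℝ) (E := ℝ)).continuous.continuousAt.comp (ca_of h.vtC hs (χ s))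
  · exact (ContinuousLinearMap.toSpanSingletonCLE (𝕜 := ℝ) (E := ℝ)).continuous.continuousAt.comp (ca_of h.vxC hs (χ s))

end
end ZN

namespace ZN
open MeasureTheory Filter Topology

section
variable {a b v vt vx vxx : ℝ → ℝ → ℝ} {M : ℝ}

lemma exp_half_sq (s : ℝ) : Real.exp (-s / 2) ^ 2 = Real.exp (-s) := by
  rw [← Real.exp_nat_mul]; congr 1; push_cast; ring

lemma Sol.OU (h : Sol a b v vt vx vxx M) {t0 : ℝ} (ht0 : 0 < t0) (x0 : ℝ) : ∃ S0 C, 0 ≤ S0 ∧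
    (∀ s, S0 < s → Real.exp (-s) ≤ t0 / 2) ∧
    OU (fun s y => v (t0 - Real.exp (-s)) (x0 + Real.exp (-s / 2) * y))
    (fun s y => Real.exp (-s) * vt (t0 - Real.exp (-s)) (x0 + Real.exp (-s / 2) * y) +
      (-(1 / 2) * Real.exp (-s / 2) * y) * vx (t0 - Real.exp (-s)) (x0 + Real.exp (-s / 2) * y))
    (fun s y => Real.exp (-s / 2) * vx (t0 - Real.exp (-s)) (x0 + Real.exp (-s / 2) * y))
    (fun s y => Real.exp (-s) * vxx (t0 - Real.exp (-s)) (x0 + Real.exp (-s / 2) * y)) S0 C M := by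
  obtain ⟨C, hC, hb⟩ := h.bdd (t1 := t0 / 2) (t2 := t0) (by linarith)
  set S0 := max 0 (-Real.log (t0 / 2)) with hS0
  have hS : ∀ s, S0 < s → Real.exp (-s) ≤ t0 / 2 := by
    intro s hs
    rw [← Real.exp_log (by linarith : 0 < t0 / 2)]
    apply Real.exp_le_exp.2
    have := le_max_right 0 (-Real.log (t0 / 2))
    linarith
  have hS1 : ∀ s, S0 < s → 0 < s := fun s hs => lt_of_le_of_lt (le_max_left _ _) hs
  have e1 : ∀ s, S0 < s → Real.exp (-s) ≤ 1 := fun s hs => Real.exp_le_one_iff.2 (by linarith [hS1 s hs])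
  have e2 : ∀ s, S0 < s → Real.exp (-s / 2) ≤ 1 := fun s hs => Real.exp_le_one_iff.2 (by linarith [hS1 s hs])
  have hpos : ∀ s, S0 < s → 0 < t0 - Real.exp (-s) := fun s hs => by linarith [hS s hs]
  have hmem : ∀ s, S0 < s → t0 - Real.exp (-s) ∈ Icc (t0 / 2) t0 := fun s hs =>
    ⟨by linarith [hS s hs], by linarith [Real.exp_pos (-s)]⟩
  have dχ : ∀ s y, HasDerivAt (fun y => x0 + Real.exp (-s / 2) * y) (Real.exp (-s / 2)) y := fun s y =>
    hd (((hasDerivAt_id y).const_mul (Real.exp (-s / 2))).const_add x0) (fun z => rfl) (by simp)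
  refine ⟨S0, C, le_max_left _ _, hS, ⟨hC, h.hM, ?_, ?_, ?_, ?_, ?_, ?_, ?_, ?_, ?_, ?_, ?_, ?_, ?_⟩⟩
  · intro s y hs
    have g1 : HasDerivAt (fun s : ℝ => t0 - Real.exp (-s)) (Real.exp (-s)) s :=
      hd (((hasDerivAt_neg s).exp).const_sub t0) (fun z => rfl) (by ring)
    have g2 : HasDerivAt (fun s : ℝ => x0 + Real.exp (-s / 2) * y) (-(1 / 2) * Real.exp (-s / 2) * y) s :=
      hd (((((hasDerivAt_neg s).div_const 2).exp).mul_const y).const_add x0) (fun z => rfl) (by ring)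
    exact h.chain (hpos s hs) g1 g2
  · intro s y hs
    exact hd ((h.dx (t0 - Real.exp (-s)) (x0 + Real.exp (-s / 2) * y) (hpos s hs)).comp y (dχ s y))
      (fun z => rfl) (by ring)
  · intro s y hs
    exact hd (((h.dxx (t0 - Real.exp (-s)) (x0 + Real.exp (-s / 2) * y) (hpos s hs)).comp y (dχ s y)).const_mul
      (Real.exp (-s / 2))) (fun z => rfl) (by rw [← exp_half_sq]; ring)
  · intro s hs
    rw [continuous_iff_continuousAt]; intro y
    have c1 := ca_comp (γ := fun _ : ℝ => t0 - Real.exp (-s)) (χ := fun y => x0 + Real.exp (-s / 2) * y) (s := y) h.vtC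
      (hpos s hs) (by fun_prop) (by fun_prop)
    have c2 := ca_comp (γ := fun _ : ℝ => t0 - Real.exp (-s)) (χ := fun y => x0 + Real.exp (-s / 2) * y) (s := y) h.vxC
      (hpos s hs) (by fun_prop) (by fun_prop)
    exact (c1.const_mul _).add (ContinuousAt.mul (by fun_prop) c2)
  · intro s hs
    rw [continuous_iff_continuousAt]; intro y
    have c1 := ca_comp (γ := fun _ : ℝ => t0 - Real.exp (-s)) (χ := fun y => x0 + Real.exp (-s / 2) * y) (s := y) h.vxxC
      (hpos s hs) (by fun_prop) (by fun_prop)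
    exact c1.const_mul _
  · intro s y hs
    have c1 := ca_comp (γ := fun s : ℝ => t0 - Real.exp (-s)) (χ := fun s => x0 + Real.exp (-s / 2) * y) (s := s) h.vxC
      (hpos s hs) (by fun_prop) (by fun_prop)
    exact ContinuousAt.mul (by fun_prop) c1
  · intro s y hs
    have c1 := ca_comp (γ := fun s : ℝ => t0 - Real.exp (-s)) (χ := fun s => x0 + Real.exp (-s / 2) * y) (s := s) h.vxxC
      (hpos s hs) (by fun_prop) (by fun_prop)
    exact ContinuousAt.mul (by fun_prop) c1
  · intro s y hs
    exact (hb _ (hmem s hs) _).1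
  · intro s y hs
    rw [abs_mul, abs_of_pos (Real.exp_pos _)]
    exact (mul_le_of_le_one_left (abs_nonneg _) (e2 s hs)).trans (hb _ (hmem s hs) _).2.2.1
  · intro s y hs
    rw [abs_mul, abs_of_pos (Real.exp_pos _)]
    exact (mul_le_of_le_one_left (abs_nonneg _) (e1 s hs)).trans (hb _ (hmem s hs) _).2.2.2
  · intro s y hs
    obtain ⟨-, b1, b2, -⟩ := hb _ (hmem s hs) (x0 + Real.exp (-s / 2) * y)
    set A1 := vt (t0 - Real.exp (-s)) (x0 + Real.exp (-s / 2) * y)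
    set A2 := vx (t0 - Real.exp (-s)) (x0 + Real.exp (-s / 2) * y)
    have g1 : |Real.exp (-s) * A1| ≤ C := by
      rw [abs_mul, abs_of_pos (Real.exp_pos _)]
      exact (mul_le_of_le_one_left (abs_nonneg _) (e1 s hs)).trans b1
    have g2 : |(-(1 / 2) * Real.exp (-s / 2) * y) * A2| ≤ |y| * C := by
      rw [abs_mul]
      apply mul_le_mul _ b2 (abs_nonneg _) (abs_nonneg _)
      rw [abs_mul, abs_mul, abs_of_pos (Real.exp_pos _)]
      apply mul_le_of_le_one_left (abs_nonneg _)
      norm_num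
      linarith [e2 s hs]
    linarith [abs_add_le (Real.exp (-s) * A1) ((-(1 / 2) * Real.exp (-s / 2) * y) * A2)]
  · intro s y hs
    have q1 := h.eq _ (x0 + Real.exp (-s / 2) * y) (hpos s hs)
    have q2 := h.aB _ (x0 + Real.exp (-s / 2) * y) (hpos s hs)
    have q3 := h.bB _ (x0 + Real.exp (-s / 2) * y) (hpos s hs)
    rw [q1]
    set A0 := v (t0 - Real.exp (-s)) (x0 + Real.exp (-s / 2) * y)
    set A2 := vx (t0 - Real.exp (-s)) (x0 + Real.exp (-s / 2) * y)
    set A3 := vxx (t0 - Real.exp (-s)) (x0 + Real.exp (-s / 2) * y)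
    set al := a (t0 - Real.exp (-s)) (x0 + Real.exp (-s / 2) * y)
    set be := b (t0 - Real.exp (-s)) (x0 + Real.exp (-s / 2) * y)
    set E := Real.exp (-s / 2) with hE
    have hE0 : 0 < E := Real.exp_pos _
    have hE1 : E ≤ 1 := e2 s hs
    rw [← exp_half_sq, ← hE]
    have : E ^ 2 * (A3 + al * A2 + be * A0) + -(1 / 2) * E * y * A2 - (E ^ 2 * A3 - y / 2 * (E * A2)) =
      E * (al * (E * A2)) + E * (be * (E * A0)) := by ring
    rw [this]
    have k1 : |E * (al * (E * A2))| ≤ E * (M * |E * A2|) := by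
      rw [abs_mul, abs_of_pos hE0, abs_mul al]; gcongr
    have k2 : |E * (be * (E * A0))| ≤ E * (M * |A0|) := by
      rw [abs_mul, abs_of_pos hE0, abs_mul be]
      have : |E * A0| ≤ |A0| := by
        rw [abs_mul, abs_of_pos hE0]; exact mul_le_of_le_one_left (abs_nonneg _) hE1
      have := h.hM
      gcongr
    calc _ ≤ _ := abs_add_le _ _
      _ ≤ _ := add_le_add k1 k2
      _ = _ := by ring
  · intro s hs
    obtain ⟨x, hx⟩ := h.nz _ (hpos s hs)
    refine ⟨(Real.exp (-s / 2))⁻¹ * (x - x0), ?_⟩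
    have : x0 + Real.exp (-s / 2) * ((Real.exp (-s / 2))⁻¹ * (x - x0)) = x := by
      field_simp; ring
    rw [this]; exact hx

lemma Sol.isolated (h : Sol a b v vt vx vxx M) {t0 : ℝ} (ht0 : 0 < t0) (x0 : ℝ) :
    ∃ r0 > 0, ∀ r, r ≠ 0 → |r| < r0 → v t0 (x0 + r) ≠ 0 := by
  obtain ⟨S0, C, hS0, hS, hOU⟩ := h.OU ht0 x0
  obtain ⟨n, hn⟩ := hOU.main
  obtain ⟨Λ, hΛ⟩ := barrier n M h.hM
  obtain ⟨Cb, hCb, hbd⟩ := h.bdd (t1 := t0 / 2) (t2 := t0) (by linarith)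
  set G := Real.exp (Λ + 3 / 2) with hG
  have hG0 : 0 < G := Real.exp_pos _
  set ε := 1 / (4 * G) with hε
  have hε0 : 0 < ε := by positivity
  obtain ⟨J, hJ, hmain⟩ := hn ε hε0
  set J1 := max J (-2 * Real.log ε) with hJ1
  refine ⟨Real.exp (-J1 / 2), Real.exp_pos _, fun r hr hr0 => ?_⟩
  have hrpos : 0 < |r| := abs_pos.2 hr
  set j := -2 * Real.log |r| with hj
  have hlog : Real.log |r| < -J1 / 2 := (Real.log_lt_iff_lt_exp hrpos).2 hr0
  have hjJ : J1 ≤ j := by rw [hj]; linarith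
  obtain ⟨s, hs, c, hc, hsc⟩ := hmain j ((le_max_left _ _).trans hjJ)
  have hsJ1 : J1 ≤ s := hjJ.trans hs.1
  have hsS : S0 < s := lt_of_lt_of_le hJ ((le_max_left _ _).trans hsJ1)
  set μ := Real.exp (-s / 2) with hμ
  have hμ0 : 0 < μ := Real.exp_pos _
  have hμ1 : μ ≤ 1 := Real.exp_le_one_iff.2 (by linarith)
  have hμ2 : μ ^ 2 = Real.exp (-s) := exp_half_sq s
  have hμε : μ ≤ ε := by
    rw [← Real.exp_log hε0]
    apply Real.exp_le_exp.2
    have := (le_max_right J (-2 * Real.log ε)).trans hsJ1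
    linarith
  have hδ : μ ^ 2 ≤ t0 / 2 := hμ2 ▸ hS s hsS
  have hmem : ∀ τ ∈ Icc (0:ℝ) 1, t0 - μ ^ 2 * (1 - τ) ∈ Icc (t0 / 2) t0 := by
    intro τ hτ
    have : μ ^ 2 * (1 - τ) ≤ μ ^ 2 := mul_le_of_le_one_right (by positivity) (by linarith [hτ.1])
    have : 0 ≤ μ ^ 2 * (1 - τ) := mul_nonneg (by positivity) (by linarith [hτ.2])
    constructor <;> linarith
  have hpos : ∀ τ ∈ Icc (0:ℝ) 1, 0 < t0 - μ ^ 2 * (1 - τ) := fun τ hτ => by linarith [(hmem τ hτ).1]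
  have dχ : ∀ y, HasDerivAt (fun y => x0 + μ * y) μ y := fun y =>
    hd (((hasDerivAt_id y).const_mul μ).const_add x0) (fun z => rfl) (by simp)
  have key := hΛ (fun τ y => v (t0 - μ ^ 2 * (1 - τ)) (x0 + μ * y))
    (fun τ y => μ ^ 2 * vt (t0 - μ ^ 2 * (1 - τ)) (x0 + μ * y))
    (fun τ y => μ * vx (t0 - μ ^ 2 * (1 - τ)) (x0 + μ * y))
    (fun τ y => μ ^ 2 * vxx (t0 - μ ^ 2 * (1 - τ)) (x0 + μ * y))
    (fun τ y => a (t0 - μ ^ 2 * (1 - τ)) (x0 + μ * y))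
    (fun τ y => b (t0 - μ ^ 2 * (1 - τ)) (x0 + μ * y)) μ c ε Cb hμ0 hμ1 hε0.le hc
    ?_ ?_ ?_ ?_ ?_ ?_ ?_ ?_ ?_ (r / μ)
  · simp only [sub_self, mul_zero, sub_zero] at key
    have e1 : μ * (r / μ) = r := by field_simp
    rw [e1] at key
    have hrj : |r| = Real.exp (-j / 2) := by
      rw [hj, ← Real.exp_log hrpos]; congr 1; simp
    have hK : |r / μ| = Real.exp ((s - j) / 2) := by
      rw [abs_div, abs_of_pos hμ0, hrj, hμ, ← Real.exp_sub]; congr 1; ring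
    have hK1 : 1 ≤ |r / μ| := by rw [hK]; exact Real.one_le_exp (by linarith [hs.1])
    have hK2 : (r / μ) ^ 2 ≤ 3 := by
      rw [← sq_abs, hK, ← Real.exp_nat_mul]
      calc _ ≤ Real.exp 1 := by apply Real.exp_le_exp.2; push_cast; linarith [hs.2]
        _ ≤ 3 := by linarith [Real.exp_one_lt_d9]
    intro h0
    rw [h0, zero_sub, abs_neg, abs_mul] at key
    have h1 : |c| * 1 ≤ |c| * |(r / μ) ^ n| := by
      gcongr; rw [abs_pow]; exact one_le_pow₀ hK1
    have h2 : |c| * (ε + μ) * Real.exp (Λ + (r / μ) ^ 2 / 2) ≤ |c| * (ε + ε) * G := by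
      exact mul_le_mul (by gcongr) (Real.exp_le_exp.2 (by linarith)) (Real.exp_pos _).le (by positivity)
    have h3 : |c| * (ε + ε) * G = |c| * (1 / 2) := by rw [hε]; field_simp; ring
    have := abs_pos.2 hc
    linarith
  · intro p hp
    exact (ca_comp (γ := fun p : ℝ × ℝ => t0 - μ ^ 2 * (1 - p.1)) (χ := fun p : ℝ × ℝ => x0 + μ * p.2) (s := p) h.vC
      (hpos p.1 hp.1) (by fun_prop) (by fun_prop)).continuousWithinAt
  · intro τ hτ y
    have g1 : HasDerivAt (fun τ : ℝ => t0 - μ ^ 2 * (1 - τ)) (μ ^ 2) τ :=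
      hd ((((hasDerivAt_id τ).const_sub 1).const_mul (μ ^ 2)).const_sub t0) (fun z => rfl) (by ring)
    exact hd (h.chain (hpos τ hτ) g1 (hasDerivAt_const τ (x0 + μ * y))) (fun z => rfl) (by ring)
  · intro τ hτ y
    exact hd ((h.dx _ (x0 + μ * y) (hpos τ hτ)).comp y (dχ y)) (fun z => rfl) (by ring)
  · intro τ hτ y
    exact hd (((h.dxx _ (x0 + μ * y) (hpos τ hτ)).comp y (dχ y)).const_mul μ) (fun z => rfl) (by ring)
  · intro τ hτ y
    rw [h.eq _ (x0 + μ * y) (hpos τ hτ)]; ring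
  · intro τ hτ y; exact h.aB _ _ (hpos τ hτ)
  · intro τ hτ y; exact h.bB _ _ (hpos τ hτ)
  · intro τ hτ y; exact (hbd _ (hmem τ hτ) _).1
  · intro y
    have := hsc y
    simp only [sub_zero, mul_one]
    rw [hμ2]; exact this

lemma Sol.fin (h : Sol a b v vt vx vxx M) {t0 : ℝ} (ht0 : 0 < t0) (p q : ℝ) :
    {x ∈ Icc p q | v t0 x = 0}.Finite := by
  by_contra hinf
  obtain ⟨x, -, hx⟩ := Set.Infinite.exists_accPt_of_subset_isCompact hinf (isCompact_Icc (a := p) (b := q))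
    (fun x hx => hx.1)
  obtain ⟨r0, hr0, hiso⟩ := h.isolated ht0 x
  rw [accPt_iff_nhds] at hx
  obtain ⟨y, ⟨hy1, hy2⟩, hy3⟩ := hx _ (Metric.ball_mem_nhds x hr0)
  refine hiso (y - x) (sub_ne_zero.2 hy3) ?_ ?_
  · rwa [Metric.mem_ball, Real.dist_eq] at hy1
  · rw [add_sub_cancel]; exact hy2.2

end
end ZN

namespace ZN
open MeasureTheory Filter Topology

section
variable {a b v vt vx vxx : ℝ → ℝ → ℝ} {M : ℝ}

lemma Sol.neg (h : Sol a b v vt vx vxx M) :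
    Sol a b (fun t x => - v t x) (fun t x => - vt t x) (fun t x => - vx t x) (fun t x => - vxx t x) M where
  hM := h.hM
  aB := h.aB
  bB := h.bB
  P := fun t x ht => by rw [h.P t x ht]
  dt := fun t x ht => (h.dt t x ht).neg
  dx := fun t x ht => (h.dx t x ht).neg
  dxx := fun t x ht => (h.dxx t x ht).neg
  vC := h.vC.neg
  vtC := h.vtC.neg
  vxC := h.vxC.neg
  vxxC := h.vxxC.neg
  eq := fun t x ht => by rw [h.eq t x ht]; ring
  nz := fun t ht => by
    obtain ⟨x, hx⟩ := h.nz t ht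
    exact ⟨x, neg_ne_zero.2 hx⟩

lemma Sol.cx (h : Sol a b v vt vx vxx M) {t : ℝ} (ht : 0 < t) : Continuous (v t) :=
  continuous_iff_continuousAt.2 fun x => (h.dx t x ht).continuousAt

lemma Sol.ct (h : Sol a b v vt vx vxx M) {t : ℝ} (ht : 0 < t) (x : ℝ) : ContinuousAt (fun s => v s x) t :=
  (h.dt t x ht).continuousAt

lemma Sol.weak (h : Sol a b v vt vx vxx M) {s0 s1 l r : ℝ} (hs0 : 0 < s0)
    (b0 : ∀ x ∈ Icc l r, 0 ≤ v s0 x) (bl : ∀ s ∈ Icc s0 s1, 0 ≤ v s l) (br : ∀ s ∈ Icc s0 s1, 0 ≤ v s r) :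
    ∀ s ∈ Icc s0 s1, ∀ x ∈ Icc l r, 0 ≤ v s x := by
  have hp : ∀ s ∈ Ioc s0 s1, 0 < s := fun s hs => hs0.trans hs.1
  have := maxprinc (Z := fun t x => - v t x) (Zs := fun t x => - vt t x) (Zx := fun t x => - vx t x)
    (Zxx := fun t x => - vxx t x) (s0 := s0) (s1 := s1) (l := l) (r := r) (A := M)
    (h.vC.neg.mono (prod_mono (fun t ht => lt_of_lt_of_le hs0 ht.1) (subset_univ _)))
    (fun s hs x _ => (h.dt s x (hp s hs)).neg) (fun s hs x _ => (h.dx s x (hp s hs)).neg)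
    (fun s hs x _ => (h.dxx s x (hp s hs)).neg) (fun x hx => by linarith [b0 x hx])
    (fun s hs => by linarith [bl s hs]) (fun s hs => by linarith [br s hs])
    (fun s hs x _ hz hzx hzxx => by
      have e1 : vx s x = 0 := by linarith
      rw [h.eq s x (hp s hs), e1]
      have e2 : b s x * (- v s x) ≤ M * (- v s x) :=
        mul_le_mul_of_nonneg_right ((le_abs_self _).trans (h.bB s x (hp s hs))) hz.le
      linarith)
  intro s hs x hx
  linarith [this s hs x hx]

lemma min_pos {f : ℝ → ℝ} {s0 s1 : ℝ} (h01 : s0 ≤ s1) (hf : ContinuousOn f (Icc s0 s1))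
    (hp : ∀ s ∈ Icc s0 s1, 0 < f s) : ∃ m > 0, ∀ s ∈ Icc s0 s1, m ≤ f s := by
  obtain ⟨t, ht, hm⟩ := isCompact_Icc.exists_isMinOn ⟨s0, left_mem_Icc.2 h01⟩ hf
  exact ⟨f t, hp t ht, fun s hs => hm hs⟩

lemma Sol.strong (h : Sol a b v vt vx vxx M) {s0 s1 l r : ℝ} (hs0 : 0 < s0) (h01 : s0 < s1) (hlr : l ≤ r)
    (b0 : ∀ x ∈ Icc l r, 0 ≤ v s0 x) (bl : ∀ s ∈ Icc s0 s1, 0 < v s l) (br : ∀ s ∈ Icc s0 s1, 0 < v s r) :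
    ∀ x ∈ Icc l r, 0 < v s1 x := by
  have hp : ∀ s ∈ Icc s0 s1, 0 < s := fun s hs => lt_of_lt_of_le hs0 hs.1
  have hw := h.weak hs0 b0 (fun s hs => (bl s hs).le) (fun s hs => (br s hs).le)
  obtain ⟨m1, hm1, hl⟩ := min_pos h01.le (fun s hs => (h.ct (hp s hs) l).continuousWithinAt) bl
  obtain ⟨m2, hm2, hr⟩ := min_pos h01.le (fun s hs => (h.ct (hp s hs) r).continuousWithinAt) br
  set c := (r - l + 1) / (s1 - s0) with hc
  have hc0 : 0 < c := by apply div_pos <;> linarith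
  have hc1 : c * (s1 - s0) = r - l + 1 := by rw [hc]; field_simp [show s1 - s0 ≠ 0 by linarith]
  have hM := h.hM
  set lam := c + 2 * M + 1 with hlam
  have hlam0 : 1 ≤ lam := by linarith
  set E : ℝ → ℝ → ℝ := fun s x => Real.exp (lam * (c * (s - s0) - (x - l))) with hE
  have hEpos : ∀ s x, 0 < E s x := fun s x => Real.exp_pos _
  set η := min m1 m2 / Real.exp (lam * (r - l + 1)) with hη
  have hη0 : 0 < η := div_pos (lt_min hm1 hm2) (Real.exp_pos _)
  have dEs : ∀ s x, HasDerivAt (fun s => E s x) (lam * c * E s x) s := by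
    intro s x
    have h1 : HasDerivAt (fun s => lam * (c * (s - s0) - (x - l))) (lam * (c * 1)) s :=
      ((((hasDerivAt_id s).sub_const s0).const_mul c).sub_const (x - l)).const_mul lam
    exact hd h1.exp (fun z => rfl) (by simp only [hE]; ring)
  have dEx : ∀ s x, HasDerivAt (fun x => E s x) (-lam * E s x) x := by
    intro s x
    have h1 : HasDerivAt (fun x => lam * (c * (s - s0) - (x - l))) (lam * (-1)) x :=
      (((hasDerivAt_id x).sub_const l).const_sub (c * (s - s0))).const_mul lam
    exact hd h1.exp (fun z => rfl) (by simp only [hE]; ring)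
  have hside : ∀ s ∈ Icc s0 s1, ∀ x, l ≤ x → η * (E s x - 1) ≤ min m1 m2 := by
    intro s hs x hx
    have h1 : E s x ≤ Real.exp (lam * (r - l + 1)) := by
      apply Real.exp_le_exp.2
      apply mul_le_mul_of_nonneg_left _ (by linarith)
      rw [← hc1]
      have : c * (s - s0) ≤ c * (s1 - s0) := mul_le_mul_of_nonneg_left (by linarith [hs.2]) hc0.le
      linarith
    calc η * (E s x - 1) ≤ η * Real.exp (lam * (r - l + 1)) := by gcongr; linarith
      _ = min m1 m2 := by rw [hη]; field_simp
  have key := maxprinc (Z := fun s x => η * (E s x - 1) - v s x) (Zs := fun s x => η * (lam * c * E s x) - vt s x)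
    (Zx := fun s x => η * (-lam * E s x) - vx s x)
    (Zxx := fun s x => η * (-lam * (-lam * E s x)) - vxx s x) (s0 := s0) (s1 := s1) (l := l) (r := r) (A := M)
    ?_ ?_ ?_ ?_ ?_ ?_ ?_ ?_
  · intro x hx
    have h1 := key s1 ⟨h01.le, le_rfl⟩ x hx
    have h2 : 1 < E s1 x := by
      apply Real.one_lt_exp_iff.2
      apply mul_pos (by linarith)
      rw [hc1]; linarith [hx.2]
    have := mul_pos hη0 (sub_pos.2 h2)
    linarith
  · have hEc : Continuous (fun p : ℝ × ℝ => η * (E p.1 p.2 - 1)) := by simp only [hE]; fun_prop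
    exact hEc.continuousOn.sub (h.vC.mono (prod_mono (fun t ht => hp t ht) (subset_univ _)))
  · intro s hs x _
    exact (((dEs s x).sub_const 1).const_mul η).sub (h.dt s x (hs0.trans hs.1))
  · intro s hs x _
    exact (((dEx s x).sub_const 1).const_mul η).sub (h.dx s x (hs0.trans hs.1))
  · intro s hs x _
    exact (((dEx s x).const_mul (-lam)).const_mul η).sub (h.dxx s x (hs0.trans hs.1))
  · intro x hx
    have : E s0 x ≤ 1 := by
      apply Real.exp_le_one_iff.2
      simp only [sub_self, mul_zero, zero_sub]
      nlinarith [hx.1]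
    have h1 : η * (E s0 x - 1) ≤ 0 := mul_nonpos_of_nonneg_of_nonpos hη0.le (by linarith)
    linarith [b0 x hx]
  · intro s hs
    linarith [hside s hs l le_rfl, hl s hs, min_le_left m1 m2]
  · intro s hs
    linarith [hside s hs r hlr, hr s hs, min_le_right m1 m2]
  · intro s hs x hx hz hzx hzxx
    have hs' : s ∈ Icc s0 s1 := ⟨hs.1.le, hs.2⟩
    have hv := hw s hs' x ⟨hx.1.le, hx.2.le⟩
    have hE1 : 0 < E s x - 1 := by
      have : 0 < η * (E s x - 1) := by linarith
      exact (mul_pos_iff_of_pos_left hη0).1 this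
    have e1 : vx s x = η * (-lam * E s x) := by linarith
    have e2 : vxx s x ≥ η * (-lam * (-lam * E s x)) := by linarith
    have hb := abs_le.1 (h.bB s x (hp s hs'))
    have ha := abs_le.1 (h.aB s x (hp s hs'))
    set z := η * (E s x - 1) - v s x with hzdef
    have ev : v s x = η * (E s x - 1) - z := by rw [hzdef]; ring
    rw [h.eq s x (hp s hs'), e1, ev]
    have t1 : a s x * (η * lam * E s x) ≤ M * (η * lam * E s x) :=
      mul_le_mul_of_nonneg_right ha.2 (by have := hEpos s x; positivity)
    have t2 : -b s x * (η * (E s x - 1)) ≤ M * (η * (E s x - 1)) :=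
      mul_le_mul_of_nonneg_right (by linarith) (by positivity)
    have t3 : b s x * z ≤ M * z := mul_le_mul_of_nonneg_right hb.2 hz.le
    have t4 : 0 ≤ (lam ^ 2 - lam * c - M * lam - M) * (η * E s x) := by
      apply mul_nonneg _ (by have := hEpos s x; positivity)
      have : lam ^ 2 - lam * c - M * lam - M = lam * (1 + M) - M := by rw [hlam]; ring
      rw [this]; nlinarith
    have t5 : 0 ≤ M * η := by positivity
    nlinarith

/-- two-point maximum principle -/
lemma Sol.twopt (h : Sol a b v vt vx vxx M) {s0 s1 l r : ℝ} (hs0 : 0 < s0)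
    (bl : ∀ s ∈ Icc s0 s1, v s l < 0) (br : ∀ s ∈ Icc s0 s1, 0 < v s r)
    (b0 : ∀ p q, l ≤ p → p ≤ q → q ≤ r → 0 < v s0 p → 0 ≤ v s0 q) :
    ∀ s ∈ Icc s0 s1, ∀ p q, l ≤ p → p ≤ q → q ≤ r → 0 < v s p → 0 ≤ v s q := by
  intro s hs p q hp hpq hq hvp
  by_contra hvq
  push Not at hvq
  have hpos : ∀ s ∈ Icc s0 s1, 0 < s := fun s hs => lt_of_lt_of_le hs0 hs.1
  set μ := 2 * M + 1 with hμ
  set Φ : ℝ × ℝ × ℝ → ℝ := fun z => Real.exp (-μ * z.1) * (max (v z.1 z.2.1) 0 * max (-v z.1 z.2.2) 0) with hΦ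
  set K : Set (ℝ × ℝ × ℝ) := (Icc s0 s1 ×ˢ (Icc l r ×ˢ Icc l r)) ∩ {z | z.2.1 ≤ z.2.2} with hK
  have hKc : IsCompact K := (isCompact_Icc.prod (isCompact_Icc.prod isCompact_Icc)).inter_right
    (isClosed_le (by fun_prop) (by fun_prop))
  have hΦc : ContinuousOn Φ K := by
    intro z hz
    have c1 := ca_comp (γ := fun z : ℝ × ℝ × ℝ => z.1) (χ := fun z : ℝ × ℝ × ℝ => z.2.1) (s := z) h.vC
      (hpos _ hz.1.1) (by fun_prop) (by fun_prop)
    have c2 := ca_comp (γ := fun z : ℝ × ℝ × ℝ => z.1) (χ := fun z : ℝ × ℝ × ℝ => z.2.2) (s := z) h.vC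
      (hpos _ hz.1.1) (by fun_prop) (by fun_prop)
    have c3 : ContinuousAt (fun z : ℝ × ℝ × ℝ => Real.exp (-μ * z.1)) z := by fun_prop
    exact (c3.mul ((c1.max continuousAt_const).mul (c2.neg.max continuousAt_const))).continuousWithinAt
  have hzK : (s, p, q) ∈ K := ⟨⟨hs, ⟨hp, hpq.trans hq⟩, ⟨hp.trans hpq, hq⟩⟩, hpq⟩
  obtain ⟨⟨t, x, y⟩, ⟨⟨ht, hx, hy⟩, hxy⟩, hmax⟩ := hKc.exists_isMaxOn ⟨_, hzK⟩ hΦc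
  simp only at ht hx hy
  have hxy' : x ≤ y := hxy
  have hmx : ∀ t' ∈ Icc s0 s1, ∀ x' y', l ≤ x' → x' ≤ y' → y' ≤ r → Φ (t', x', y') ≤ Φ (t, x, y) :=
    fun t' ht' x' y' h1 h2 h3 => hmax (show (t', x', y') ∈ K from
      ⟨⟨ht', ⟨h1, h2.trans h3⟩, ⟨h1.trans h2, h3⟩⟩, h2⟩)
  have hΦpos : 0 < Φ (t, x, y) := by
    refine lt_of_lt_of_le ?_ (hmx s hs p q hp hpq hq)
    simp only [hΦ]
    exact mul_pos (Real.exp_pos _) (mul_pos (lt_max_of_lt_left hvp) (lt_max_of_lt_left (by linarith)))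
  have hprod : 0 < max (v t x) 0 * max (-v t y) 0 := (mul_pos_iff_of_pos_left (Real.exp_pos _)).1 hΦpos
  have hA : 0 < v t x := by
    by_contra hcon
    rw [max_eq_right (not_lt.1 hcon), zero_mul] at hprod
    exact lt_irrefl _ hprod
  have hB : 0 < -v t y := by
    by_contra hcon
    rw [max_eq_right (not_lt.1 hcon), mul_zero] at hprod
    exact lt_irrefl _ hprod
  have hxy1 : x < y := by
    refine lt_of_le_of_ne hxy' ?_
    rintro rfl; linarith
  have hlx : l < x := by
    refine lt_of_le_of_ne hx.1 ?_
    rintro rfl; linarith [bl t ht]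
  have hyr : y < r := by
    refine lt_of_le_of_ne hy.2 ?_
    rintro rfl; linarith [br t ht]
  have hts : s0 < t := by
    refine lt_of_le_of_ne ht.1 ?_
    rintro rfl
    linarith [b0 x y hx.1 hxy' hy.2 hA]
  have ht0 := hpos t ht
  have hval : Φ (t, x, y) = Real.exp (-μ * t) * (v t x * -v t y) := by
    simp only [hΦ]; rw [max_eq_left hA.le, max_eq_left hB.le]
  obtain ⟨p1, p2⟩ := second_deriv_nonpos (f := fun z => v t z) (f' := fun z => vx t z) (l := l) (r := y) (x := x)
    ⟨hlx, hxy1⟩ (fun z _ => h.dx t z ht0) (h.dxx t x ht0) (fun z hz => by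
      have h1 := hmx t ht z y hz.1.le hz.2.le hy.2
      simp only [hΦ] at h1
      have h2 := le_of_mul_le_mul_left h1 (Real.exp_pos _)
      have h3 := le_of_mul_le_mul_right h2 (lt_max_of_lt_left hB)
      rw [max_eq_left hA.le] at h3
      exact (le_max_left _ _).trans h3)
  obtain ⟨q1, q2⟩ := second_deriv_nonpos (f := fun z => -v t z) (f' := fun z => -vx t z) (l := x) (r := r) (x := y)
    ⟨hxy1, hyr⟩ (fun z _ => (h.dx t z ht0).neg) (h.dxx t y ht0).neg (fun z hz => by
      have h1 := hmx t ht x z hx.1 hz.1.le hz.2.le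
      simp only [hΦ] at h1
      have h2 := le_of_mul_le_mul_left h1 (Real.exp_pos _)
      have h3 := le_of_mul_le_mul_left h2 (lt_max_of_lt_left hA)
      rw [max_eq_left hB.le] at h3
      exact (le_max_left _ _).trans h3)
  -- time derivative
  have hev : ∀ᶠ s in 𝓝[<] t, 0 < v s x ∧ 0 < -v s y := by
    have e1 := (h.ct ht0 x).eventually (lt_mem_nhds hA)
    have e2 := ((h.ct ht0 y).neg).eventually (lt_mem_nhds hB)
    exact (e1.and e2).filter_mono nhdsWithin_le_nhds
  obtain ⟨u, hu, hsub⟩ := (mem_nhdsLT_iff_exists_Ioo_subset).1 hev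
  have hu' : u < t := hu
  set u1 := max s0 ((u + t) / 2) with hu1
  have hu1t : u1 < t := max_lt hts (by linarith)
  have hder : HasDerivAt (fun s => Real.exp (-μ * s) * (v s x * -v s y))
      (Real.exp (-μ * t) * (-μ * 1) * (v t x * -v t y) +
        Real.exp (-μ * t) * (vt t x * -v t y + v t x * -vt t y)) t := by
    have h4 : HasDerivAt (fun t => Real.exp (-μ * t)) (Real.exp (-μ * t) * (-μ * 1)) t :=
      ((hasDerivAt_id t).const_mul (-μ)).exp
    exact h4.mul ((h.dt t x ht0).mul (h.dt t y ht0).neg)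
  have h5 := left_deriv_nonneg hu1t hder (fun t' ht' => by
    rcases eq_or_lt_of_le ht'.2 with he | hlt
    · rw [he]
    · have hu2 : (u + t) / 2 ≤ u1 := le_max_right _ _
      have hpp : 0 < v t' x ∧ 0 < -v t' y := hsub ⟨by linarith [ht'.1], hlt⟩
      have h1 := hmx t' ⟨(le_max_left _ _).trans ht'.1, ht'.2.trans ht.2⟩ x y hx.1 hxy' hy.2
      rw [hval] at h1
      simp only [hΦ] at h1
      rwa [max_eq_left hpp.1.le, max_eq_left hpp.2.le] at h1)
  have hbx := mul_le_mul_of_nonneg_right ((le_abs_self _).trans (h.bB t x ht0)) hA.le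
  have hby := mul_le_mul_of_nonneg_right ((le_abs_self _).trans (h.bB t y ht0)) hB.le
  have hq1 : vx t y = 0 := by linarith
  have r1 : vt t x ≤ M * v t x := by rw [h.eq t x ht0, p1]; linarith
  have r2 : -vt t y ≤ M * -v t y := by rw [h.eq t y ht0, hq1]; linarith
  have r3 : vt t x * -v t y ≤ M * v t x * -v t y := mul_le_mul_of_nonneg_right r1 hB.le
  have r4 : v t x * -vt t y ≤ v t x * (M * -v t y) := mul_le_mul_of_nonneg_left r2 hA.le
  have r5 : Real.exp (-μ * t) * (-μ * 1) * (v t x * -v t y) +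
        Real.exp (-μ * t) * (vt t x * -v t y + v t x * -vt t y) =
      Real.exp (-μ * t) * (-μ * (v t x * -v t y) + (vt t x * -v t y + v t x * -vt t y)) := by ring
  rw [r5] at h5
  have h6 := (mul_nonneg_iff_of_pos_left (Real.exp_pos _)).1 h5
  have r6 : 0 < v t x * -v t y := mul_pos hA hB
  rw [hμ] at h6
  nlinarith

end
end ZN

namespace ZN
open MeasureTheory Filter Topology

section
variable {a b v vt vx vxx : ℝ → ℝ → ℝ} {M : ℝ}

lemma sign_pos {f : ℝ → ℝ} (hf : Continuous f) {p q y : ℝ} (hz : ∀ z ∈ Icc p q, f z ≠ 0)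
    (hy : y ∈ Icc p q) (hp : 0 < f y) : ∀ z ∈ Icc p q, 0 < f z := by
  intro z hzm
  by_contra hn
  have hn : f z ≤ 0 := not_lt.1 hn
  obtain ⟨w, hw, hw0⟩ := (isPreconnected_Icc (a := p) (b := q)).intermediate_value hzm hy hf.continuousOn ⟨hn, hp.le⟩
  exact hz w hw hw0

lemma sign_neg {f : ℝ → ℝ} (hf : Continuous f) {p q y : ℝ} (hz : ∀ z ∈ Icc p q, f z ≠ 0)
    (hy : y ∈ Icc p q) (hp : f y < 0) : ∀ z ∈ Icc p q, f z < 0 := by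
  intro z hzm
  have := sign_pos (f := fun x => - f x) hf.neg (fun z hz' => neg_ne_zero.2 (hz z hz')) hy (neg_pos.2 hp) z hzm
  exact neg_pos.1 this

lemma Sol.nbp (h : Sol a b v vt vx vxx M) {t0 l : ℝ} (ht0 : 0 < t0) (hl : 0 < v t0 l) :
    ∃ δ > 0, ∀ s, |s - t0| < δ → 0 < s ∧ 0 < v s l := by
  have h1 : ∀ᶠ s in 𝓝 t0, 0 < s ∧ 0 < v s l :=
    (eventually_gt_nhds ht0).and ((h.ct ht0 l).eventually (eventually_gt_nhds hl))
  obtain ⟨δ, hδ, hb⟩ := Metric.eventually_nhds_iff.1 h1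
  exact ⟨δ, hδ, fun s hs => hb (by rwa [Real.dist_eq])⟩

lemma Sol.nbn (h : Sol a b v vt vx vxx M) {t0 l : ℝ} (ht0 : 0 < t0) (hl : v t0 l < 0) :
    ∃ δ > 0, ∀ s, |s - t0| < δ → 0 < s ∧ v s l < 0 := by
  obtain ⟨δ, hδ, hb⟩ := h.neg.nbp ht0 (neg_pos.2 hl)
  exact ⟨δ, hδ, fun s hs => ⟨(hb s hs).1, neg_pos.1 (hb s hs).2⟩⟩

lemma Sol.A1pos (h : Sol a b v vt vx vxx M) {t0 l r x : ℝ} (ht0 : 0 < t0) (hlx : l < x) (hxr : x < r)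
    (hl : 0 < v t0 l) (hr : v t0 r ≠ 0) (hx : v t0 x = 0) :
    ∃ δ > 0, ∀ t, t0 - δ < t → t < t0 → ∃ y ∈ Ioo l r, v t y = 0 := by
  have hlr : l ≤ r := (hlx.trans hxr).le
  obtain ⟨δ1, hδ1, h1⟩ := h.nbp ht0 hl
  rcases lt_or_gt_of_ne hr with hr | hr
  · obtain ⟨δ2, hδ2, h2⟩ := h.nbn ht0 hr
    refine ⟨min δ1 δ2, lt_min hδ1 hδ2, fun t h3 h4 => ?_⟩
    have e : |t - t0| < min δ1 δ2 := by rw [abs_lt]; constructor <;> linarith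
    have q1 := h1 t (e.trans_le (min_le_left _ _))
    have q2 := h2 t (e.trans_le (min_le_right _ _))
    obtain ⟨y, hy, hy0⟩ := intermediate_value_Ioo' hlr (h.cx q1.1).continuousOn ⟨q2.2, q1.2⟩
    exact ⟨y, hy, hy0⟩
  · obtain ⟨δ2, hδ2, h2⟩ := h.nbp ht0 hr
    refine ⟨min δ1 δ2, lt_min hδ1 hδ2, fun t h3 h4 => ?_⟩
    have e : ∀ s ∈ Icc t t0, |s - t0| < min δ1 δ2 := by
      intro s hs
      rw [abs_lt]; constructor <;> linarith [hs.1, hs.2, lt_min hδ1 hδ2]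
    have q1 := fun s hs => h1 s ((e s hs).trans_le (min_le_left _ _))
    have q2 := fun s hs => h2 s ((e s hs).trans_le (min_le_right _ _))
    have ht : t ∈ Icc t t0 := ⟨le_rfl, h4.le⟩
    by_contra hno
    have hz : ∀ z ∈ Icc l r, v t z ≠ 0 := by
      intro z hz hz0
      rcases eq_or_lt_of_le hz.1 with e1 | e1
      · rw [← e1] at hz0; exact (q1 t ht).2.ne' hz0
      rcases eq_or_lt_of_le hz.2 with e2 | e2
      · rw [e2] at hz0; exact (q2 t ht).2.ne' hz0
      exact hno ⟨z, ⟨e1, e2⟩, hz0⟩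
    have hp := sign_pos (h.cx (q1 t ht).1) hz ⟨le_rfl, hlr⟩ (q1 t ht).2
    have := h.strong (q1 t ht).1 h4 hlr (fun z hz => (hp z hz).le) (fun s hs => (q1 s hs).2)
      (fun s hs => (q2 s hs).2) x ⟨hlx.le, hxr.le⟩
    linarith

lemma Sol.A1 (h : Sol a b v vt vx vxx M) {t0 l r x : ℝ} (ht0 : 0 < t0) (hlx : l < x) (hxr : x < r)
    (hl : v t0 l ≠ 0) (hr : v t0 r ≠ 0) (hx : v t0 x = 0) :
    ∃ δ > 0, ∀ t, t0 - δ < t → t < t0 → ∃ y ∈ Ioo l r, v t y = 0 := by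
  rcases lt_or_gt_of_ne hl with hl | hl
  · obtain ⟨δ, hδ, hh⟩ := h.neg.A1pos ht0 hlx hxr (neg_pos.2 hl) (neg_ne_zero.2 hr) (by rw [hx, neg_zero])
    refine ⟨δ, hδ, fun t h1 h2 => ?_⟩
    obtain ⟨y, hy, hy0⟩ := hh t h1 h2
    exact ⟨y, hy, neg_eq_zero.1 hy0⟩
  · exact h.A1pos ht0 hlx hxr hl hr hx

lemma Sol.B1pp (h : Sol a b v vt vx vxx M) {t0 l r x : ℝ} (ht0 : 0 < t0) (hlx : l < x) (hxr : x < r)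
    (hl : 0 < v t0 l) (hr : 0 < v t0 r) (hx : v t0 x = 0) (hn : ∀ y ∈ Icc l r, y ≠ x → v t0 y ≠ 0) :
    ∃ δ > 0, ∀ t, t0 < t → t < t0 + δ → ∀ y ∈ Icc l r, v t y ≠ 0 := by
  have hlr : l ≤ r := (hlx.trans hxr).le
  obtain ⟨δ1, hδ1, h1⟩ := h.nbp ht0 hl
  obtain ⟨δ2, hδ2, h2⟩ := h.nbp ht0 hr
  refine ⟨min δ1 δ2, lt_min hδ1 hδ2, fun t h3 h4 => ?_⟩
  have e : ∀ s ∈ Icc t0 t, |s - t0| < min δ1 δ2 := by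
    intro s hs
    rw [abs_lt]; constructor <;> linarith [hs.1, hs.2, lt_min hδ1 hδ2]
  have q1 := fun s hs => h1 s ((e s hs).trans_le (min_le_left _ _))
  have q2 := fun s hs => h2 s ((e s hs).trans_le (min_le_right _ _))
  have b0 : ∀ z ∈ Icc l r, 0 ≤ v t0 z := by
    intro z hz
    rcases lt_trichotomy z x with hzx | hzx | hzx
    · exact (sign_pos (p := l) (q := z) (h.cx ht0) (fun w hw => hn w ⟨hw.1, hw.2.trans hz.2⟩ (by linarith [hw.2]))
        ⟨le_rfl, hz.1⟩ hl z ⟨hz.1, le_rfl⟩).le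
    · rw [hzx, hx]
    · exact (sign_pos (p := z) (q := r) (h.cx ht0) (fun w hw => hn w ⟨hz.1.trans hw.1, hw.2⟩ (by linarith [hw.1]))
        ⟨hz.2, le_rfl⟩ hr z ⟨le_rfl, hz.2⟩).le
  intro y hy
  exact (h.strong ht0 h3 hlr b0 (fun s hs => (q1 s hs).2) (fun s hs => (q2 s hs).2) y hy).ne'

lemma Sol.B1np (h : Sol a b v vt vx vxx M) {t0 l r x : ℝ} (ht0 : 0 < t0) (hlx : l < x) (hxr : x < r)
    (hl : v t0 l < 0) (hr : 0 < v t0 r) (hx : v t0 x = 0) (hn : ∀ y ∈ Icc l r, y ≠ x → v t0 y ≠ 0) :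
    ∃ δ > 0, ∀ t, t0 < t → t < t0 + δ → ∀ y ∈ Icc l r, ∀ y' ∈ Icc l r, v t y = 0 → v t y' = 0 → ¬ y < y' := by
  have hlr : l ≤ r := (hlx.trans hxr).le
  obtain ⟨δ1, hδ1, h1⟩ := h.nbn ht0 hl
  obtain ⟨δ2, hδ2, h2⟩ := h.nbp ht0 hr
  refine ⟨min δ1 δ2, lt_min hδ1 hδ2, fun t h3 h4 => ?_⟩
  have e : ∀ s ∈ Icc t0 t, |s - t0| < min δ1 δ2 := by
    intro s hs
    rw [abs_lt]; constructor <;> linarith [hs.1, hs.2, lt_min hδ1 hδ2]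
  have q1 := fun s hs => h1 s ((e s hs).trans_le (min_le_left _ _))
  have q2 := fun s hs => h2 s ((e s hs).trans_le (min_le_right _ _))
  have tp := h.twopt (l := l) (r := r) (s1 := t) ht0 (fun s hs => (q1 s hs).2) (fun s hs => (q2 s hs).2) (by
    intro p q hp hpq hq hvp
    rcases le_or_gt p x with hpx | hpx
    · exfalso
      rcases eq_or_lt_of_le hpx with hpx | hpx
      · rw [hpx, hx] at hvp; exact lt_irrefl _ hvp
      · have := sign_neg (p := l) (q := p) (h.cx ht0) (fun w hw => hn w ⟨hw.1, by linarith [hw.2]⟩ (by linarith [hw.2]))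
          ⟨le_rfl, hp⟩ hl p ⟨hp, le_rfl⟩
        linarith
    · exact (sign_pos (p := p) (q := r) (h.cx ht0) (fun w hw => hn w ⟨hp.trans hw.1, hw.2⟩ (by linarith [hw.1]))
        ⟨by linarith, le_rfl⟩ hr q ⟨hpq, hq⟩).le)
  intro y hy y' hy' hy0 hy0' hlt
  have ht : 0 < t := ht0.trans h3
  obtain ⟨m, hm, hm0⟩ : ∃ m ∈ Icc y y', v t m ≠ 0 := by
    by_contra hno
    have hno : ∀ m ∈ Icc y y', v t m = 0 := fun m hm => by_contra fun h0 => hno ⟨m, hm, h0⟩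
    exact (Icc_infinite hlt) ((h.fin ht y y').subset fun m hm => ⟨hm, hno m hm⟩)
  have hlm : l ≤ m := hy.1.trans hm.1
  have hmr : m ≤ r := hm.2.trans hy'.2
  rcases lt_or_gt_of_ne hm0 with hm0 | hm0
  · obtain ⟨δ3, hδ3, h5⟩ := h.nbn ht hm0
    obtain ⟨s0, hs0, hs0t⟩ := exists_between (max_lt h3 (show t - δ3 < t by linarith))
    have h6 := (le_max_left _ _).trans_lt hs0
    have h7 := (le_max_right _ _).trans_lt hs0
    have hin : ∀ s ∈ Icc s0 t, s ∈ Icc t0 t := fun s hs => ⟨h6.le.trans hs.1, hs.2⟩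
    have q3 : ∀ s ∈ Icc s0 t, v s m < 0 := fun s hs => (h5 s (by
      rw [abs_lt]; constructor <;> linarith [hs.1, hs.2])).2
    have := h.neg.strong (l := l) (r := m) (ht0.trans h6) hs0t hlm (by
        intro w hw
        by_contra hc
        have hc : 0 < v s0 w := by
          have := not_le.1 hc
          linarith
        have := tp s0 ⟨h6.le, hs0t.le⟩ w m hw.1 hw.2 hmr hc
        have := q3 s0 ⟨le_rfl, hs0t.le⟩
        linarith)
      (fun s hs => neg_pos.2 (q1 s (hin s hs)).2) (fun s hs => neg_pos.2 (q3 s hs)) y ⟨hy.1, hm.1⟩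
    have : 0 < - v t y := this
    linarith
  · obtain ⟨δ3, hδ3, h5⟩ := h.nbp ht hm0
    obtain ⟨s0, hs0, hs0t⟩ := exists_between (max_lt h3 (show t - δ3 < t by linarith))
    have h6 := (le_max_left _ _).trans_lt hs0
    have h7 := (le_max_right _ _).trans_lt hs0
    have hin : ∀ s ∈ Icc s0 t, s ∈ Icc t0 t := fun s hs => ⟨h6.le.trans hs.1, hs.2⟩
    have q3 : ∀ s ∈ Icc s0 t, 0 < v s m := fun s hs => (h5 s (by
      rw [abs_lt]; constructor <;> linarith [hs.1, hs.2])).2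
    have := h.strong (l := m) (r := r) (ht0.trans h6) hs0t hmr
      (fun w hw => tp s0 ⟨h6.le, hs0t.le⟩ m w hlm hw.1 hw.2 (q3 s0 ⟨le_rfl, hs0t.le⟩))
      q3 (fun s hs => (q2 s (hin s hs)).2) y' ⟨hm.2, hy'.2⟩
    linarith

lemma Sol.B1 (h : Sol a b v vt vx vxx M) {t0 l r x : ℝ} (ht0 : 0 < t0) (hlx : l < x) (hxr : x < r)
    (hx : v t0 x = 0) (hn : ∀ y ∈ Icc l r, y ≠ x → v t0 y ≠ 0) :
    ∃ δ > 0, ∀ t, t0 < t → t < t0 + δ → ∀ y ∈ Icc l r, ∀ y' ∈ Icc l r, v t y = 0 → v t y' = 0 → y = y' := by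
  have hlr : l ≤ r := (hlx.trans hxr).le
  have hl := hn l ⟨le_rfl, hlr⟩ hlx.ne
  have hr := hn r ⟨hlr, le_rfl⟩ hxr.ne'
  have hn' : ∀ y ∈ Icc l r, y ≠ x → - v t0 y ≠ 0 := fun y hy hyx => neg_ne_zero.2 (hn y hy hyx)
  have hx' : - v t0 x = 0 := by rw [hx, neg_zero]
  rcases lt_or_gt_of_ne hl with hl | hl <;> rcases lt_or_gt_of_ne hr with hr | hr
  · obtain ⟨δ, hδ, hh⟩ := h.neg.B1pp ht0 hlx hxr (neg_pos.2 hl) (neg_pos.2 hr) hx' hn'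
    exact ⟨δ, hδ, fun t h1 h2 y hy y' hy' e e' => absurd (neg_eq_zero.2 e) (hh t h1 h2 y hy)⟩
  · obtain ⟨δ, hδ, hh⟩ := h.B1np ht0 hlx hxr hl hr hx hn
    refine ⟨δ, hδ, fun t h1 h2 y hy y' hy' e e' => ?_⟩
    exact le_antisymm (not_lt.1 (hh t h1 h2 y' hy' y hy e' e)) (not_lt.1 (hh t h1 h2 y hy y' hy' e e'))
  · obtain ⟨δ, hδ, hh⟩ := h.neg.B1np ht0 hlx hxr (neg_neg_iff_pos.2 hl) (neg_pos.2 hr) hx' hn'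
    refine ⟨δ, hδ, fun t h1 h2 y hy y' hy' e e' => ?_⟩
    have e := neg_eq_zero.2 e
    have e' := neg_eq_zero.2 e'
    exact le_antisymm (not_lt.1 (hh t h1 h2 y' hy' y hy e' e)) (not_lt.1 (hh t h1 h2 y hy y' hy' e e'))
  · obtain ⟨δ, hδ, hh⟩ := h.B1pp ht0 hlx hxr hl hr hx hn
    exact ⟨δ, hδ, fun t h1 h2 y hy y' hy' e e' => absurd e (hh t h1 h2 y hy)⟩

end
end ZN

namespace ZN
open MeasureTheory Filter Topology

section
variable {a b v vt vx vxx : ℝ → ℝ → ℝ} {M : ℝ}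

/-- zeros of `v t` in one period starting at `c` -/
def Zs (v : ℝ → ℝ → ℝ) (c t : ℝ) : Set ℝ := {x ∈ Ico c (c + 2 * π) | v t x = 0}

lemma Sol.Zfin (h : Sol a b v vt vx vxx M) {t : ℝ} (ht : 0 < t) (c : ℝ) : (Zs v c t).Finite :=
  (h.fin ht c (c + 2 * π)).subset fun _ hx => ⟨⟨hx.1.1, hx.1.2.le⟩, hx.2⟩

lemma Sol.Zle (h : Sol a b v vt vx vxx M) {t : ℝ} (ht : 0 < t) (c d : ℝ) :
    (Zs v c t).ncard ≤ (Zs v d t).ncard := by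
  refine Set.ncard_le_ncard_of_injOn (toIcoMod Real.two_pi_pos d) ?_ ?_ (h.Zfin ht d)
  · intro x hx
    refine ⟨toIcoMod_mem_Ico _ _ _, ?_⟩
    have hP : Function.Periodic (v t) (2 * π) := fun x => h.P t x ht
    have := hP.sub_zsmul_eq (x := x) (toIcoDiv Real.two_pi_pos d x)
    rw [self_sub_toIcoDiv_zsmul] at this
    rw [this]; exact hx.2
  · intro x hx y hy hxy
    have e := congrArg (toIcoMod Real.two_pi_pos c) hxy
    simp only [toIcoMod_toIcoMod] at e
    rwa [(toIcoMod_eq_self Real.two_pi_pos).2 hx.1, (toIcoMod_eq_self Real.two_pi_pos).2 hy.1] at e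

lemma Sol.Zeq (h : Sol a b v vt vx vxx M) {t : ℝ} (ht : 0 < t) (c d : ℝ) :
    (Zs v c t).ncard = (Zs v d t).ncard := le_antisymm (h.Zle ht c d) (h.Zle ht d c)

lemma Sol.boxes (h : Sol a b v vt vx vxx M) {t0 c : ℝ} (ht0 : 0 < t0) (hc : v t0 c ≠ 0) :
    ∃ ε > 0, ∀ x ∈ Zs v c t0, c < x - ε ∧ x + ε < c + 2 * π ∧
      (∀ y ∈ Icc (x - ε) (x + ε), y ≠ x → v t0 y ≠ 0) ∧
      (∀ x' ∈ Zs v c t0, x < x' → x + ε < x' - ε) := by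
  have key : ∀ x ∈ Zs v c t0, ∀ᶠ ε in 𝓝[>] (0:ℝ), c < x - ε ∧ x + ε < c + 2 * π ∧
      (∀ y ∈ Icc (x - ε) (x + ε), y ≠ x → v t0 y ≠ 0) ∧
      (∀ x' ∈ Zs v c t0, x < x' → x + ε < x' - ε) := by
    intro x hx
    obtain ⟨r0, hr0, hiso⟩ := h.isolated ht0 x
    have hcx : c < x := lt_of_le_of_ne hx.1.1 (fun e => hc (by rw [e]; exact hx.2))
    have hm : 0 < min (r0 / 2) (min (x - c) (c + 2 * π - x)) :=
      lt_min (by linarith) (lt_min (by linarith) (by linarith [hx.1.2]))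
    filter_upwards [Ioo_mem_nhdsGT hm] with ε hε
    have h1 := hε.2.trans_le (min_le_left _ _)
    have h2 := hε.2.trans_le ((min_le_right _ _).trans (min_le_left _ _))
    have h3 := hε.2.trans_le ((min_le_right _ _).trans (min_le_right _ _))
    refine ⟨by linarith, by linarith, ?_, ?_⟩
    · intro y hy hyx
      have := hiso (y - x) (sub_ne_zero.2 hyx) (by rw [abs_lt]; constructor <;> linarith [hy.1, hy.2])
      rwa [add_sub_cancel] at this
    · intro x' hx' hlt
      by_contra hcon
      have hcon := not_lt.1 hcon
      have := hiso (x' - x) (by linarith) (by rw [abs_lt]; constructor <;> linarith)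
      rw [add_sub_cancel] at this
      exact this hx'.2
  have := ((h.Zfin ht0 c).eventually_all).2 key
  obtain ⟨ε, hε, hpos⟩ := (this.and self_mem_nhdsWithin).exists
  exact ⟨ε, hpos, hε⟩

lemma Sol.claimA (h : Sol a b v vt vx vxx M) {t0 : ℝ} (ht0 : 0 < t0) :
    ∀ᶠ t in 𝓝[<] t0, (Zs v 0 t0).ncard ≤ (Zs v 0 t).ncard := by
  obtain ⟨c, hc⟩ := h.nz t0 ht0
  obtain ⟨ε, hε, hb⟩ := h.boxes ht0 hc
  have key : ∀ x ∈ Zs v c t0, ∀ᶠ t in 𝓝[<] t0, ∃ y ∈ Ioo (x - ε) (x + ε), v t y = 0 := by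
    intro x hx
    obtain ⟨h1, h2, h3, -⟩ := hb x hx
    obtain ⟨δ, hδ, hA⟩ := h.A1 (l := x - ε) (r := x + ε) ht0 (by linarith) (by linarith)
      (h3 _ ⟨le_rfl, by linarith⟩ (by linarith)) (h3 _ ⟨by linarith, le_rfl⟩ (by linarith)) hx.2
    filter_upwards [Ioo_mem_nhdsLT (show t0 - δ < t0 by linarith)] with t ht using hA t ht.1 ht.2
  filter_upwards [((h.Zfin ht0 c).eventually_all).2 key, Ioo_mem_nhdsLT ht0] with t ht htp
  rw [h.Zeq ht0 0 c, h.Zeq htp.1 0 c]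
  choose! g hg hg0 using ht
  refine Set.ncard_le_ncard_of_injOn g ?_ ?_ (h.Zfin htp.1 c)
  · intro x hx
    obtain ⟨h1, h2, -, -⟩ := hb x hx
    have := hg x hx
    exact ⟨⟨by linarith [this.1], by linarith [this.2]⟩, hg0 x hx⟩
  · intro x hx x' hx' e
    have q := hg x hx
    have q' := hg x' hx'
    rcases lt_trichotomy x x' with hlt | hlt | hlt
    · have := (hb x hx).2.2.2 x' hx' hlt
      linarith [q.2, q'.1]
    · exact hlt
    · have := (hb x' hx').2.2.2 x hx hlt
      linarith [q.1, q'.2]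

lemma Sol.claimB (h : Sol a b v vt vx vxx M) {t0 : ℝ} (ht0 : 0 < t0) :
    ∀ᶠ t in 𝓝[>] t0, (Zs v 0 t).ncard ≤ (Zs v 0 t0).ncard := by
  obtain ⟨c, hc⟩ := h.nz t0 ht0
  obtain ⟨ε, hε, hb⟩ := h.boxes ht0 hc
  have key : ∀ x ∈ Zs v c t0, ∀ᶠ t in 𝓝[>] t0, ∀ y ∈ Icc (x - ε) (x + ε), ∀ y' ∈ Icc (x - ε) (x + ε),
      v t y = 0 → v t y' = 0 → y = y' := by
    intro x hx
    obtain ⟨h1, h2, h3, -⟩ := hb x hx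
    obtain ⟨δ, hδ, hA⟩ := h.B1 (l := x - ε) (r := x + ε) ht0 (by linarith) (by linarith) hx.2 h3
    filter_upwards [Ioo_mem_nhdsGT (show t0 < t0 + δ by linarith)] with t ht using hA t ht.1 ht.2
  let K : Set ℝ := Icc c (c + 2 * π) \ ⋃ x ∈ Zs v c t0, Ioo (x - ε) (x + ε)
  have hK : IsCompact K := isCompact_Icc.diff (isOpen_biUnion fun _ _ => isOpen_Ioo)
  have hK0 : ∀ y ∈ K, v t0 y ≠ 0 := by
    intro y hy h0
    rcases eq_or_lt_of_le hy.1.2 with e | e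
    · rw [e, h.P t0 c ht0] at h0; exact hc h0
    · exact hy.2 (mem_biUnion (show y ∈ Zs v c t0 from ⟨⟨hy.1.1, e⟩, h0⟩) ⟨by linarith, by linarith⟩)
  have hKe : ∀ᶠ t in 𝓝 t0, ∀ y ∈ K, v t y ≠ 0 :=
    hK.eventually_forall_of_forall_eventually (P := fun t y => v t y ≠ 0)
      fun y hy => (ca_of h.vC ht0 y).eventually_ne (hK0 y hy)
  filter_upwards [((h.Zfin ht0 c).eventually_all).2 key, self_mem_nhdsWithin,
    nhdsWithin_le_nhds hKe] with t ht htp hKt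
  have htp : 0 < t := ht0.trans htp
  rw [h.Zeq ht0 0 c, h.Zeq htp 0 c]
  have hg : ∀ y ∈ Zs v c t, ∃ x ∈ Zs v c t0, y ∈ Ioo (x - ε) (x + ε) := by
    intro y hy
    by_contra hno
    refine hKt y ⟨⟨hy.1.1, hy.1.2.le⟩, fun hm => ?_⟩ hy.2
    obtain ⟨x, hx, hyx⟩ := mem_iUnion₂.1 hm
    exact hno ⟨x, hx, hyx⟩
  choose! g hg hgm using hg
  refine Set.ncard_le_ncard_of_injOn g hg ?_ (h.Zfin ht0 c)
  intro y hy y' hy' e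
  have q := hgm y' hy'
  rw [← e] at q
  exact ht (g y) (hg y hy) y (Ioo_subset_Icc_self (hgm y hy)) y' (Ioo_subset_Icc_self q) hy.2 hy'.2

lemma Sol.mono (h : Sol a b v vt vx vxx M) {t1 t2 : ℝ} (ht1 : 0 < t1) (h12 : t1 ≤ t2) :
    (Zs v 0 t2).ncard ≤ (Zs v 0 t1).ncard := by
  let S : Set ℝ := {t ∈ Icc t1 t2 | ∀ t' ∈ Icc t1 t, (Zs v 0 t').ncard ≤ (Zs v 0 t1).ncard}
  have h1S : t1 ∈ S := ⟨⟨le_rfl, h12⟩, fun t' ht' => by rw [le_antisymm ht'.2 ht'.1]⟩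
  have hbd : BddAbove S := ⟨t2, fun t ht => ht.1.2⟩
  set T := sSup S with hT
  have hT1 : t1 ≤ T := le_csSup hbd h1S
  have hT2 : T ≤ t2 := csSup_le ⟨t1, h1S⟩ fun t ht => ht.1.2
  have hT0 : 0 < T := ht1.trans_le hT1
  have hlt : ∀ t', t1 ≤ t' → t' < T → (Zs v 0 t').ncard ≤ (Zs v 0 t1).ncard := by
    intro t' h1 h2
    obtain ⟨s, hs, hs'⟩ := exists_lt_of_lt_csSup ⟨t1, h1S⟩ h2
    exact hs.2 t' ⟨h1, hs'.le⟩
  have hTT : (Zs v 0 T).ncard ≤ (Zs v 0 t1).ncard := by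
    rcases eq_or_lt_of_le hT1 with e | e
    · rw [← e]
    · obtain ⟨t, ht, ht'⟩ := ((h.claimA hT0).and (Ioo_mem_nhdsLT e)).exists
      exact ht.trans (hlt t ht'.1.le ht'.2)
  rcases eq_or_lt_of_le hT2 with e | e
  · rwa [← e]
  exfalso
  obtain ⟨u, hu, hsub⟩ := (mem_nhdsGT_iff_exists_Ioo_subset).1 (h.claimB hT0)
  obtain ⟨s, hs1, hs2⟩ := exists_between (lt_min (show T < u from hu) e)
  have hsS : s ∈ S := by
    refine ⟨⟨by linarith, (hs2.trans_le (min_le_right _ _)).le⟩, fun t' ht' => ?_⟩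
    rcases lt_trichotomy t' T with q | q | q
    · exact hlt t' ht'.1 q
    · rw [q]; exact hTT
    · exact le_trans (hsub ⟨q, ht'.2.trans_lt (hs2.trans_le (min_le_left _ _))⟩) hTT
  exact absurd (le_csSup hbd hsS) (not_le.2 hs1)

end
end ZN


/-- Zero number properties (finiteness and monotonicity) for a nontrivial classical
solution of a linear parabolic equation `v_t = v_xx + a v_x + b v` on the circle
`S¹ = ℝ/2πℤ`. -/
theorem zero_number_finite_and_monotone
    (a b v vt vx vxx : ℝ → ℝ → ℝ)
    -- `a`, `b` are bounded continuous on `[0,∞) × ℝ`, `2π`-periodic in `x`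
    (haC : ContinuousOn (fun p : ℝ × ℝ => a p.1 p.2) (Set.Ici 0 ×ˢ Set.univ))
    (hbC : ContinuousOn (fun p : ℝ × ℝ => b p.1 p.2) (Set.Ici 0 ×ˢ Set.univ))
    (haB : ∃ M : ℝ, ∀ t x : ℝ, 0 ≤ t → |a t x| ≤ M)
    (hbB : ∃ M : ℝ, ∀ t x : ℝ, 0 ≤ t → |b t x| ≤ M)
    (haP : ∀ t x : ℝ, 0 ≤ t → a t (x + 2 * π) = a t x)
    (hbP : ∀ t x : ℝ, 0 ≤ t → b t (x + 2 * π) = b t x)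
    -- `v` is continuous on `[0,∞) × ℝ` and `2π`-periodic in `x`
    (hvC : ContinuousOn (fun p : ℝ × ℝ => v p.1 p.2) (Set.Ici 0 ×ˢ Set.univ))
    (hvP : ∀ t x : ℝ, 0 ≤ t → v t (x + 2 * π) = v t x)
    -- the partial derivatives `v_t, v_x, v_xx` exist on `(0,∞) × ℝ`
    (hvt : ∀ t x : ℝ, 0 < t → HasDerivAt (fun s => v s x) (vt t x) t)
    (hvx : ∀ t x : ℝ, 0 < t → HasDerivAt (fun y => v t y) (vx t x) x)
    (hvxx : ∀ t x : ℝ, 0 < t → HasDerivAt (fun y => vx t y) (vxx t x) x)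
    -- and are continuous on `(0,∞) × ℝ`
    (hvtC : ContinuousOn (fun p : ℝ × ℝ => vt p.1 p.2) (Set.Ioi 0 ×ˢ Set.univ))
    (hvxC : ContinuousOn (fun p : ℝ × ℝ => vx p.1 p.2) (Set.Ioi 0 ×ˢ Set.univ))
    (hvxxC : ContinuousOn (fun p : ℝ × ℝ => vxx p.1 p.2) (Set.Ioi 0 ×ˢ Set.univ))
    -- the equation holds on `(0,∞) × ℝ`
    (heq : ∀ t x : ℝ, 0 < t → vt t x = vxx t x + a t x * vx t x + b t x * v t x)
    -- `v(t,·)` is not identically zero for every `t ≥ 0`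
    (hnz : ∀ t : ℝ, 0 ≤ t → ∃ x : ℝ, v t x ≠ 0) :
    (∀ t : ℝ, 0 < t → {x ∈ Set.Ico 0 (2 * π) | v t x = 0}.Finite) ∧
    (∀ t₁ t₂ : ℝ, 0 < t₁ → t₁ ≤ t₂ →
      {x ∈ Set.Ico 0 (2 * π) | v t₂ x = 0}.ncard ≤
        {x ∈ Set.Ico 0 (2 * π) | v t₁ x = 0}.ncard) := by
  obtain ⟨Ma, hMa⟩ := haB
  obtain ⟨Mb, hMb⟩ := hbB
  have h : ZN.Sol a b v vt vx vxx (max (max Ma Mb) 0) :=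
    { hM := le_max_right _ _
      aB := fun t x ht => (hMa t x ht.le).trans ((le_max_left _ _).trans (le_max_left _ _))
      bB := fun t x ht => (hMb t x ht.le).trans ((le_max_right _ _).trans (le_max_left _ _))
      P := fun t x ht => hvP t x ht.le
      dt := hvt
      dx := hvx
      dxx := hvxx
      vC := hvC.mono (Set.prod_mono Set.Ioi_subset_Ici_self (Set.subset_univ _))
      vtC := hvtC
      vxC := hvxC
      vxxC := hvxxC
      eq := heq
      nz := fun t ht => hnz t ht.le }
  have e : ∀ t, ZN.Zs v 0 t = {x ∈ Set.Ico 0 (2 * π) | v t x = 0} := by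
    intro t
    simp only [ZN.Zs, zero_add]
  refine ⟨fun t ht => ?_, fun t₁ t₂ h1 h12 => ?_⟩
  · rw [← e t]
    exact h.Zfin ht 0
  · rw [← e t₁, ← e t₂]
    exact h.mono h1 h12
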